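/- Let s > d/2 and σ ≥ 2, assume the exact solution of the Zakharov system satisfies ‖ψ(t)‖_{s+2+σ} + |||(u(t),u̇(t))|||_{s+σ} ≤ M for 0 ≤ t−t₀ ≤ T with M ≥ 1, assume the a priori bound ‖φ_n^K‖_s + |||(u_n^K,u̇_n^K)|||_s ≤ 2C₀M on the fully discrete solution for τ ≤ t_n−t₀ ≤ T, and assume the CFL condition d τ K^2 ≤ c < 2π. Then there is a constant C, depending only on d, s, σ, M, T and c, such that ‖ψ̂_{P,n}^K − ψ_{P,n}^K‖_{s+2} ≤ C e_n^K for 0 ≤ t_n−t₀ ≤ T. -/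

import Mathlib

noncomputable section

namespace Zak

/-- Fourier coefficients of a function on the `d`-dimensional torus `𝕋^d`. -/
abbrev Coef (d : ℕ) := (Fin d → ℤ) → ℂ

/-- Euclidean norm `|j|` of a frequency `j ∈ ℤ^d`. -/
def absZ {d : ℕ} (j : Fin d → ℤ) : ℝ := Real.sqrt (∑ i, ((j i : ℝ)) ^ 2)

/-- Sobolev norm `‖v‖ₛ = (∑_j max(|j|,1)^{2s} |v_j|²)^{1/2}`. -/
def sobNorm {d : ℕ} (s : ℝ) (v : Coef d) : ℝ :=
  Real.sqrt (∑' j : Fin d → ℤ, (max (absZ j) 1) ^ (2 * s) * ‖v j‖ ^ 2)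

/-- Norm `|||(v, v̇)|||ₛ = (‖v‖_{s+1}² + ‖v̇‖ₛ²)^{1/2}` on `H^{s+1} × H^s`. -/
def pairNorm {d : ℕ} (s : ℝ) (v w : Coef d) : ℝ :=
  Real.sqrt (sobNorm (s + 1) v ^ 2 + sobNorm s w ^ 2)

/-- Convolution of Fourier coefficients (= product of the functions). -/
def conv {d : ℕ} (v w : Coef d) : Coef d := fun j => ∑' k : Fin d → ℤ, v k * w (j - k)

/-- Fourier coefficients of the complex conjugate function. -/
def conjC {d : ℕ} (v : Coef d) : Coef d := fun j => (starRingEnd ℂ) (v (-j))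

/-- Fourier coefficients of `|v|² = v ⬝ conj v`. -/
def absSq {d : ℕ} (v : Coef d) : Coef d := conv v (conjC v)

/-- Fourier coefficients of the real part of the function. -/
def reC {d : ℕ} (v : Coef d) : Coef d := fun j => (v j + (starRingEnd ℂ) (v (-j))) / 2

/-- Membership of a frequency in `𝒦 = {-K, …, K-1}^d`. -/
def inK (d K : ℕ) (j : Fin d → ℤ) : Prop := ∀ i, -(K : ℤ) ≤ j i ∧ j i < K

/-- Trigonometric polynomial of degree `K`: only modes in `𝒦` are present. -/
def isTrig (d K : ℕ) (v : Coef d) : Prop := ∀ j, ¬ inK d K j → v j = 0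

/-- The function is real-valued: conjugate-symmetric Fourier coefficients. -/
def isReal {d : ℕ} (v : Coef d) : Prop := ∀ j, v (-j) = (starRingEnd ℂ) (v j)

open Classical in
/-- Trigonometric interpolation `𝓘` of degree `K` at the collocation points
`x_k = kπ/K`, expressed through aliasing of Fourier coefficients. -/
def interp (d K : ℕ) (v : Coef d) : Coef d := fun j =>
  if inK d K j then ∑' m : Fin d → ℤ, v (j + (2 * (K : ℤ)) • m) else 0

/-- Fourier multiplier with symbol `g(|j|)`. -/
def mulOp {d : ℕ} (g : ℝ → ℂ) (v : Coef d) : Coef d := fun j => g (absZ j) * v j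

/-- `sinc ξ = sin ξ / ξ`, `sinc 0 = 1`. -/
def sinc (x : ℝ) : ℝ := if x = 0 then 1 else Real.sin x / x

/-- Convolution powers `v^{*n}` (with `v^{*0} = δ₀`). -/
def convPow {d : ℕ} (v : Coef d) : ℕ → Coef d
  | 0 => fun j => if j = 0 then 1 else 0
  | n + 1 => conv v (convPow v n)

/-- Composition with the exponential: Fourier coefficients of `e^{v}`. -/
def expC {d : ℕ} (v : Coef d) : Coef d :=
  fun j => ∑' n : ℕ, ((n.factorial : ℂ))⁻¹ * convPow v n j

/-- Composition with `ϕ(ξ) = (e^ξ - 1)/ξ = ∑ ξ^n/(n+1)!`. -/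
def phiC {d : ℕ} (v : Coef d) : Coef d :=
  fun j => ∑' n : ℕ, (((n + 1).factorial : ℂ))⁻¹ * convPow v n j

/-- The wave propagator matrix
`R(t) = [[cos(tΩ), t sinc(tΩ)], [-Ω sin(tΩ), cos(tΩ)]]`. -/
def Rop {d : ℕ} (t : ℝ) (p : Coef d × Coef d) : Coef d × Coef d :=
  (fun j => ((Real.cos (t * absZ j) : ℝ) : ℂ) * p.1 j
      + ((t * sinc (t * absZ j) : ℝ) : ℂ) * p.2 j,
   fun j => -(((absZ j * Real.sin (t * absZ j) : ℝ)) : ℂ) * p.1 j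
      + ((Real.cos (t * absZ j) : ℝ) : ℂ) * p.2 j)

/-- The operator `(Ω² ϕ(iτΩ²) + 1)⁻¹`, multiplying the `j`-th Fourier coefficient
by `iτ/(e^{iτ|j|²} - 1 + iτ)`. -/
def poissonInv (d : ℕ) (τ : ℝ) (v : Coef d) : Coef d :=
  fun j => (Complex.I * (τ : ℂ) /
      (Complex.exp (Complex.I * (τ : ℂ) * ((absZ j : ℝ) : ℂ) ^ 2) - 1 + Complex.I * (τ : ℂ))) * v j

/-- The operator `(Ω² + 1)⁻¹ = (-Δ + 1)⁻¹`. -/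
def laplInv (d : ℕ) (v : Coef d) : Coef d :=
  fun j => ((((absZ j) ^ 2 + 1 : ℝ)) : ℂ)⁻¹ * v j

/-- The free Schrödinger propagator `e^{-iτΩ²} = e^{iτΔ}`. -/
def freeOp {d : ℕ} (τ : ℝ) : Coef d → Coef d :=
  mulOp (fun x => Complex.exp (-Complex.I * (τ : ℂ) * ((x : ℂ)) ^ 2))

/-- The inverse free propagator `e^{iτΩ²}`. -/
def freeOpInv {d : ℕ} (τ : ℝ) : Coef d → Coef d :=
  mulOp (fun x => Complex.exp (Complex.I * (τ : ℂ) * ((x : ℂ)) ^ 2))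

/-- The operator `sinc(τΩ)`. -/
def sincOp {d : ℕ} (τ : ℝ) : Coef d → Coef d := mulOp (fun x => ((sinc (τ * x) : ℝ) : ℂ))

/-- The operator `sinc(τΩ/2)²`. -/
def sincHalfSqOp {d : ℕ} (τ : ℝ) : Coef d → Coef d :=
  mulOp (fun x => ((sinc (τ * x / 2) ^ 2 : ℝ) : ℂ))

/-- The operator `sinc(τΩ) - 1`. -/
def sincm1Op {d : ℕ} (τ : ℝ) : Coef d → Coef d := mulOp (fun x => ((sinc (τ * x) - 1 : ℝ) : ℂ))

/-- The Zakharov system in first-order form, `i∂_tψ = -Δψ + uψ`, `∂_t u = u̇`,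
`∂_t u̇ = Δu + Δ|ψ|²`, with `u`, `u̇` real-valued, formulated mode-wise for the
Fourier coefficients. -/
def ZakSol (d : ℕ) (ψ u ud : ℝ → Coef d) : Prop :=
  (∀ t j, HasDerivAt (fun r => ψ r j)
      (-Complex.I * (((absZ j ^ 2 : ℝ) : ℂ) * ψ t j + conv (u t) (ψ t) j)) t) ∧
  (∀ t j, HasDerivAt (fun r => u r j) (ud t j) t) ∧
  (∀ t j, HasDerivAt (fun r => ud r j)
      (-((absZ j ^ 2 : ℝ) : ℂ) * (u t j + absSq (ψ t) j)) t) ∧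
  (∀ t, isReal (u t)) ∧ (∀ t, isReal (ud t))

/-- The Fourier collocation semi-discretization in space of the Zakharov system:
`i∂_tψ^K = -Δψ^K + 𝓘(u^K ψ^K)`, `∂_t u^K = u̇^K`, `∂_t u̇^K = Δu^K + Δ𝓘(|ψ^K|²)`
for trigonometric polynomials of degree `K`. -/
def ZakSolK (d K : ℕ) (ψ u ud : ℝ → Coef d) : Prop :=
  (∀ t, isTrig d K (ψ t) ∧ isTrig d K (u t) ∧ isTrig d K (ud t)) ∧
  (∀ t j, HasDerivAt (fun r => ψ r j)
      (-Complex.I * (((absZ j ^ 2 : ℝ) : ℂ) * ψ t j + interp d K (conv (u t) (ψ t)) j)) t) ∧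
  (∀ t j, HasDerivAt (fun r => u r j) (ud t j) t) ∧
  (∀ t j, HasDerivAt (fun r => ud r j)
      (-((absZ j ^ 2 : ℝ) : ℂ) * (u t j + interp d K (absSq (ψ t)) j)) t)

/-- Interpolated initial values `ψ^K(t₀) = 𝓘(ψ(t₀))` etc. -/
def initK (d K : ℕ) (t₀ : ℝ) (ψ u ud ψK uK udK : ℝ → Coef d) : Prop :=
  ψK t₀ = interp d K (ψ t₀) ∧ uK t₀ = interp d K (u t₀) ∧ udK t₀ = interp d K (ud t₀)

/-- The new variable `φ = ∂_tψ`, expressed via the Schrödinger equation. -/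
def phiEx (d : ℕ) (ψ u : ℝ → Coef d) : ℝ → Coef d :=
  fun t j => -Complex.I * (((absZ j ^ 2 : ℝ) : ℂ) * ψ t j + conv (u t) (ψ t) j)

/-- The semi-discrete new variable `φ^K = ∂_tψ^K`, expressed via the semi-discrete
Schrödinger equation. -/
def phiK (d K : ℕ) (ψ u : ℝ → Coef d) : ℝ → Coef d :=
  fun t j => -Complex.I * (((absZ j ^ 2 : ℝ) : ℂ) * ψ t j + interp d K (conv (u t) (ψ t)) j)

/-- Regularity assumption `‖ψ(t)‖_{s+2+σ} + |||(u(t),u̇(t))|||_{s+σ} ≤ M` on `[t₀, t₀+T]`. -/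
def regBound (d : ℕ) (s σ M T t₀ : ℝ) (ψ u ud : ℝ → Coef d) : Prop :=
  ∀ t, t₀ ≤ t → t ≤ t₀ + T → sobNorm (s + 2 + σ) (ψ t) + pairNorm (s + σ) (u t) (ud t) ≤ M

/-- The CFL-type step-size restriction `d τ K² ≤ c`. -/
def CFL (d K : ℕ) (τ c : ℝ) : Prop := (d : ℝ) * τ * (K : ℝ) ^ 2 ≤ c

/-- The semi-discretization error quantity
`e(t) = sup_{t₀ ≤ t' ≤ t} (‖φ(t')-φ^K(t')‖ₛ + |||(u,u̇)(t') - (u^K,u̇^K)(t')|||ₛ)`. -/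
def errSemi (d K : ℕ) (s t₀ : ℝ) (ψ u ud ψK uK udK : ℝ → Coef d) (t : ℝ) : ℝ :=
  sSup ((fun r =>
    sobNorm s (phiEx d ψ u r - phiK d K ψK uK r)
      + pairNorm s (u r - uK r) (ud r - udK r)) '' Set.Icc t₀ t)

/-- `v_{n+1}^K = sinc(τΩ) u_n^K + (τ/2) sinc(τΩ/2)² u̇_n^K + (sinc(τΩ)-1) 𝓘(|ψ_n^K|²)`. -/
def vOrig (d K : ℕ) (τ : ℝ) (u ud ψ : Coef d) : Coef d :=
  sincOp τ u + ((τ / 2 : ℝ) : ℂ) • sincHalfSqOp τ ud + sincm1Op τ (interp d K (absSq ψ))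

/-- `ψ_{n+1}^K = e^{-iτΩ²} 𝓘(e^{-iτ v} ψ_n^K)`. -/
def psiStep (d K : ℕ) (τ : ℝ) (v ψ : Coef d) : Coef d :=
  freeOp τ (interp d K (conv (expC ((-Complex.I * (τ : ℂ)) • v)) ψ))

/-- `(u_{n+1}, u̇_{n+1}) = R(τ)(u_n, u̇_n) + (R(τ)-1)(q, 0)`. -/
def uStep {d : ℕ} (τ : ℝ) (u ud q : Coef d) : Coef d × Coef d :=
  ((Rop τ (u, ud)).1 + (Rop τ (q, 0)).1 - q, (Rop τ (u, ud)).2 + (Rop τ (q, 0)).2)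

/-- The Lie–Trotter splitting method of Jin, Markowich and Zheng. -/
def LieTrotter (d K : ℕ) (τ : ℝ) (ψn un udn : ℕ → Coef d) : Prop :=
  ∀ n : ℕ,
    ψn (n + 1) = psiStep d K τ (vOrig d K τ (un n) (udn n) (ψn n)) (ψn n) ∧
    un (n + 1) = (uStep τ (un n) (udn n) (interp d K (absSq (ψn n)))).1 ∧
    udn (n + 1) = (uStep τ (un n) (udn n) (interp d K (absSq (ψn n)))).2

/-- Interpolated starting values for the fully discrete method. -/
def initFull (d K : ℕ) (t₀ : ℝ) (ψ u ud : ℝ → Coef d) (ψn un udn : ℕ → Coef d) : Prop :=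
  ψn 0 = interp d K (ψ t₀) ∧ un 0 = interp d K (u t₀) ∧ udn 0 = interp d K (ud t₀)

/-- Discrete new variable `φ_n^K = (ψ_n^K - ψ_{n-1}^K)/τ`. -/
def phin {d : ℕ} (τ : ℝ) (ψn : ℕ → Coef d) (n : ℕ) : Coef d :=
  ((τ : ℂ))⁻¹ • (ψn n - ψn (n - 1))

/-- `v = sinc(τΩ) u - (τ/2) sinc(τΩ/2)² u̇ + (sinc(τΩ)-1) 𝓘(|p|²)` (new variables). -/
def vNew (d K : ℕ) (τ : ℝ) (u ud p : Coef d) : Coef d :=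
  sincOp τ u - ((τ / 2 : ℝ) : ℂ) • sincHalfSqOp τ ud + sincm1Op τ (interp d K (absSq p))

/-- `w = sinc(τΩ/2)² u̇ + (sinc(τΩ)-1) 𝓘(Re((p_cur + p_prev) conj φ))`. -/
def wNew (d K : ℕ) (τ : ℝ) (ud pcur pprev φ : Coef d) : Coef d :=
  sincHalfSqOp τ ud + sincm1Op τ (interp d K (reC (conv (pcur + pprev) (conjC φ))))

/-- One step of the method in the new variables:
`φ ↦ e^{-iτΩ²} 𝓘(e^{-iτv} (φ - iτ w ϕ(-iτ²w) p))`. -/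
def phiStepNew (d K : ℕ) (τ : ℝ) (v w φ p : Coef d) : Coef d :=
  freeOp τ (interp d K (conv (expC ((-Complex.I * (τ : ℂ)) • v))
    (φ - (Complex.I * (τ : ℂ)) • conv w (conv (phiC ((-Complex.I * (τ : ℂ) ^ 2) • w)) p))))

/-- `ψ_P = (Ω²ϕ(iτΩ²)+1)⁻¹ 𝓘(iφ + p - v ϕ(iτv) e^{iτΩ²} p)`. -/
def psiPNew (d K : ℕ) (τ : ℝ) (φ p v : Coef d) : Coef d :=
  poissonInv d τ (interp d K (Complex.I • φ + p -
    conv v (conv (phiC ((Complex.I * (τ : ℂ)) • v)) (freeOpInv τ p))))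

/-- Discrete new variable `v_n^K`. -/
def vn (d K : ℕ) (τ : ℝ) (ψn un udn : ℕ → Coef d) (n : ℕ) : Coef d :=
  vNew d K τ (un n) (udn n) (ψn (n - 1))

/-- Discrete new variable `w_n^K`. -/
def wn (d K : ℕ) (τ : ℝ) (ψn un udn : ℕ → Coef d) (n : ℕ) : Coef d :=
  wNew d K τ (udn n) (ψn n) (ψn (n - 1)) (phin τ ψn n)

/-- Discrete new variable `ψ_{P,n}^K` (with `ψ_{P,0}^K = ψ₀^K`). -/
def psiPn (d K : ℕ) (τ : ℝ) (ψn un udn : ℕ → Coef d) (n : ℕ) : Coef d :=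
  if n = 0 then ψn 0 else
    psiPNew d K τ (phin τ ψn n) (ψn n) (vn d K τ ψn un udn n)

/-- Intermediate quantity `ψ̂_{I,n}^K = ψ₀^K + τ(φ^K(t₁) + … + φ^K(t_n))`. -/
def psiIhat (d K : ℕ) (τ t₀ : ℝ) (ψK uK : ℝ → Coef d) (n : ℕ) : Coef d :=
  ψK t₀ + (τ : ℂ) • ∑ m ∈ Finset.range n, phiK d K ψK uK (t₀ + ((m : ℝ) + 1) * τ)

/-- Intermediate quantity `v̂_n^K`. -/
def vhat (d K : ℕ) (τ t₀ : ℝ) (ψK uK udK : ℝ → Coef d) (n : ℕ) : Coef d :=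
  vNew d K τ (uK (t₀ + (n : ℝ) * τ)) (udK (t₀ + (n : ℝ) * τ)) (psiIhat d K τ t₀ ψK uK (n - 1))

/-- Intermediate quantity `ŵ_n^K`. -/
def what (d K : ℕ) (τ t₀ : ℝ) (ψK uK udK : ℝ → Coef d) (n : ℕ) : Coef d :=
  wNew d K τ (udK (t₀ + (n : ℝ) * τ)) (psiIhat d K τ t₀ ψK uK n)
    (psiIhat d K τ t₀ ψK uK (n - 1)) (phiK d K ψK uK (t₀ + (n : ℝ) * τ))

/-- Intermediate quantity `φ̂_{n+1}^K` (as a function of `n`). -/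
def phihatSucc (d K : ℕ) (τ t₀ : ℝ) (ψK uK udK : ℝ → Coef d) (n : ℕ) : Coef d :=
  phiStepNew d K τ (vhat d K τ t₀ ψK uK udK n) (what d K τ t₀ ψK uK udK n)
    (phiK d K ψK uK (t₀ + (n : ℝ) * τ)) (psiIhat d K τ t₀ ψK uK n)

/-- Intermediate quantity `ψ̂_{P,n}^K` (with `ψ̂_{P,0}^K = ψ₀^K`). -/
def psiPhat (d K : ℕ) (τ t₀ : ℝ) (ψK uK udK : ℝ → Coef d) (n : ℕ) : Coef d :=
  if n = 0 then ψK t₀ else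
    psiPNew d K τ (phiK d K ψK uK (t₀ + (n : ℝ) * τ)) (psiIhat d K τ t₀ ψK uK n)
      (vhat d K τ t₀ ψK uK udK n)

/-- Intermediate quantity `(û_{n+1}^K, û̇_{n+1}^K)` (as a function of `n`). -/
def uhatSucc (d K : ℕ) (τ t₀ : ℝ) (ψK uK udK : ℝ → Coef d) (n : ℕ) : Coef d × Coef d :=
  uStep τ (uK (t₀ + (n : ℝ) * τ)) (udK (t₀ + (n : ℝ) * τ))
    (interp d K (absSq (psiPhat d K τ t₀ ψK uK udK n)))

/-- The fully discrete error quantity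
`e_n^K = max_{1 ≤ j ≤ n} (‖φ^K(t_j) - φ_j^K‖ₛ + |||(u^K,u̇^K)(t_j) - (u_j^K,u̇_j^K)|||ₛ)`,
with `e₀^K = 0`. -/
def errFull (d K : ℕ) (s τ t₀ : ℝ) (ψK uK udK : ℝ → Coef d)
    (ψn un udn : ℕ → Coef d) (n : ℕ) : ℝ :=
  sSup ((fun m : ℕ =>
    sobNorm s (phiK d K ψK uK (t₀ + (m : ℝ) * τ) - phin τ ψn m)
      + pairNorm s (uK (t₀ + (m : ℝ) * τ) - un m) (udK (t₀ + (m : ℝ) * τ) - udn m))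
    '' Set.Icc 1 n)

/-- Higher-order regularity bound on the semi-discrete solution (with constant `C₀`). -/
def regHighK (d K : ℕ) (s C₀ T t₀ : ℝ) (ψK uK udK : ℝ → Coef d) : Prop :=
  ∀ t, t₀ ≤ t → t ≤ t₀ + T →
    sobNorm (s + 4) (ψK t) + pairNorm (s + 2) (uK t) (udK t)
      + sobNorm (s + 2) (phiK d K ψK uK t) ≤ C₀

/-- A priori bound `‖φ_n^K‖ₛ + |||(u_n^K,u̇_n^K)|||ₛ ≤ B` for `τ ≤ t_n - t₀ ≤ T`
on the fully discrete solution. -/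
def aprioriFull {d : ℕ} (s B T τ : ℝ) (ψn un udn : ℕ → Coef d) : Prop :=
  ∀ n : ℕ, 1 ≤ n → (n : ℝ) * τ ≤ T →
    sobNorm s (phin τ ψn n) + pairNorm s (un n) (udn n) ≤ B

open scoped ENNReal NNReal

/-! ### ENNReal-valued `ℓ²` norms -/

/-- The `ℓ²` norm of an extended nonnegative family. -/
def F2 {ι : Type} (f : ι → ℝ≥0∞) : ℝ≥0∞ := (∑' i, f i ^ 2) ^ (1 / 2 : ℝ)

lemma F2_sq {ι : Type} (f : ι → ℝ≥0∞) : F2 f ^ 2 = ∑' i, f i ^ 2 := by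
  unfold F2
  rw [← ENNReal.rpow_natCast, ← ENNReal.rpow_mul]
  norm_num

lemma le_of_sq_le {a b : ℝ≥0∞} (h : a ^ 2 ≤ b ^ 2) : a ≤ b := by
  exact (ENNReal.pow_le_pow_left_iff two_ne_zero).1 h

lemma F2_mono {ι : Type} {f g : ι → ℝ≥0∞} (h : ∀ i, f i ≤ g i) : F2 f ≤ F2 g := by
  unfold F2
  gcongr with i
  exact h i

lemma F2_const_mul {ι : Type} (c : ℝ≥0∞) (f : ι → ℝ≥0∞) : F2 (fun i => c * f i) = c * F2 f := by
  apply le_antisymm <;> apply le_of_sq_le <;>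
  · simp only [F2_sq, mul_pow, ENNReal.tsum_mul_left]
    exact le_rfl

lemma le_F2 {ι : Type} (f : ι → ℝ≥0∞) (i : ι) : f i ≤ F2 f := by
  apply le_of_sq_le
  rw [F2_sq]
  exact ENNReal.le_tsum i

lemma F2_cs {ι : Type} (f g : ι → ℝ≥0∞) : ∑' i, f i * g i ≤ F2 f * F2 g := by
  let _ : MeasurableSpace ι := ⊤
  have h := ENNReal.lintegral_mul_le_Lp_mul_Lq (MeasureTheory.Measure.count : MeasureTheory.Measure ι)
    Real.HolderConjugate.two_two
    (f := f) (g := g) (measurable_from_top.aemeasurable) (measurable_from_top.aemeasurable)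
  simp only [MeasureTheory.lintegral_count, Pi.mul_apply] at h
  simpa [F2] using h

lemma F2_tsum {ι κ : Type} (g : κ → ι → ℝ≥0∞) :
    F2 (fun i => ∑' n, g n i) ≤ ∑' n, F2 (g n) := by
  apply le_of_sq_le
  rw [F2_sq]
  calc ∑' i, (∑' n, g n i) ^ 2 = ∑' i, ∑' n, ∑' m, g n i * g m i := by
        congr 1; ext i; rw [sq, ← ENNReal.tsum_mul_right]; congr 1; ext n
        rw [ENNReal.tsum_mul_left]
    _ = ∑' n, ∑' m, ∑' i, g n i * g m i := by
        rw [ENNReal.tsum_comm]; congr 1; ext n; rw [ENNReal.tsum_comm]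
    _ ≤ ∑' n, ∑' m, F2 (g n) * F2 (g m) := by
        gcongr with n m; exact F2_cs _ _
    _ = (∑' n, F2 (g n)) ^ 2 := by
        rw [sq, ← ENNReal.tsum_mul_right]; congr 1; ext n
        rw [ENNReal.tsum_mul_left]

lemma F2_add {ι : Type} (f g : ι → ℝ≥0∞) : F2 (fun i => f i + g i) ≤ F2 f + F2 g := by
  have h := F2_tsum (fun b : Bool => fun i => if b then f i else g i)
  simpa [tsum_bool, add_comm] using h

lemma F2_comp_equiv {ι κ : Type} (e : ι ≃ κ) (f : κ → ℝ≥0∞) : F2 (fun i => f (e i)) = F2 f := by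
  unfold F2
  rw [e.tsum_eq (fun i => f i ^ 2)]

/-! ### Weights -/

/-- `max(|j|,1)`. -/
def wt {d : ℕ} (j : Fin d → ℤ) : ℝ := max (absZ j) 1

lemma one_le_wt {d : ℕ} (j : Fin d → ℤ) : 1 ≤ wt j := le_max_right _ _

lemma wt_pos {d : ℕ} (j : Fin d → ℤ) : 0 < wt j := lt_of_lt_of_le one_pos (one_le_wt j)

/-- `max(|j|,1)^s` as an extended nonnegative number. -/
def W {d : ℕ} (s : ℝ) (j : Fin d → ℤ) : ℝ≥0∞ := ENNReal.ofReal (wt j ^ s)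

lemma one_le_W {d : ℕ} {s : ℝ} (hs : 0 ≤ s) (j : Fin d → ℤ) : 1 ≤ W s j := by
  unfold W
  rw [ENNReal.one_le_ofReal]
  exact Real.one_le_rpow (one_le_wt j) hs

lemma W_ne_zero {d : ℕ} (s : ℝ) (j : Fin d → ℤ) : W s j ≠ 0 := by
  unfold W
  rw [Ne, ENNReal.ofReal_eq_zero, not_le]
  exact Real.rpow_pos_of_pos (wt_pos j) s

lemma W_ne_top {d : ℕ} (s : ℝ) (j : Fin d → ℤ) : W s j ≠ ⊤ := ENNReal.ofReal_ne_top

lemma W_mono {d : ℕ} {s r : ℝ} (h : s ≤ r) (j : Fin d → ℤ) : W s j ≤ W r j :=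
  ENNReal.ofReal_le_ofReal (Real.rpow_le_rpow_of_exponent_le (one_le_wt j) h)

lemma absZ_eq_norm {d : ℕ} (j : Fin d → ℤ) :
    absZ j = ‖(WithLp.toLp 2 (fun i => (j i : ℝ)) : EuclideanSpace ℝ (Fin d))‖ := by
  simp [absZ, EuclideanSpace.norm_eq]

lemma absZ_nonneg {d : ℕ} (j : Fin d → ℤ) : 0 ≤ absZ j := Real.sqrt_nonneg _

lemma absZ_sq {d : ℕ} (j : Fin d → ℤ) : absZ j ^ 2 = ∑ i, ((j i : ℝ)) ^ 2 :=
  Real.sq_sqrt (Finset.sum_nonneg fun _ _ => sq_nonneg _)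

lemma absZ_neg {d : ℕ} (j : Fin d → ℤ) : absZ (-j) = absZ j := by
  simp [absZ]

lemma wt_neg {d : ℕ} (j : Fin d → ℤ) : wt (-j) = wt j := by simp [wt, absZ_neg]

lemma absZ_add_le {d : ℕ} (j k : Fin d → ℤ) : absZ (j + k) ≤ absZ j + absZ k := by
  simp only [absZ_eq_norm]
  refine le_trans (le_of_eq ?_) (norm_add_le _ _)
  congr 1
  ext i
  simp

lemma abs_le_absZ {d : ℕ} (j : Fin d → ℤ) (i : Fin d) : |(j i : ℝ)| ≤ absZ j := by
  unfold absZ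
  apply Real.abs_le_sqrt
  exact Finset.single_le_sum (f := fun i => ((j i : ℝ)) ^ 2) (fun _ _ => sq_nonneg _)
    (Finset.mem_univ i)

lemma wt_add_le {d : ℕ} (j k : Fin d → ℤ) : wt (j + k) ≤ wt j + wt k := by
  have h1 := absZ_add_le j k
  have h2 := one_le_wt j
  have h3 := one_le_wt k
  have h4 : absZ j ≤ wt j := le_max_left _ _
  have h5 : absZ k ≤ wt k := le_max_left _ _
  exact max_le (by linarith) (by linarith)

lemma W_add_le {d : ℕ} {s : ℝ} (hs : 0 ≤ s) (j k : Fin d → ℤ) :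
    W s (j + k) ≤ ENNReal.ofReal (2 ^ s) * (W s j + W s k) := by
  unfold W
  rw [← ENNReal.ofReal_add (Real.rpow_nonneg (wt_pos j).le s) (Real.rpow_nonneg (wt_pos k).le s),
    ← ENNReal.ofReal_mul (by positivity)]
  apply ENNReal.ofReal_le_ofReal
  have hj := Real.rpow_nonneg (wt_pos j).le s
  have hk := Real.rpow_nonneg (wt_pos k).le s
  have h2 : (0:ℝ) ≤ 2 ^ s := by positivity
  rcases le_total (wt j) (wt k) with h | h
  · calc wt (j + k) ^ s ≤ (2 * wt k) ^ s :=
          Real.rpow_le_rpow (wt_pos _).le (by linarith [wt_add_le j k]) hs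
      _ = 2 ^ s * wt k ^ s := Real.mul_rpow (by norm_num) (wt_pos k).le
      _ ≤ _ := by nlinarith
  · calc wt (j + k) ^ s ≤ (2 * wt j) ^ s :=
          Real.rpow_le_rpow (wt_pos _).le (by linarith [wt_add_le j k]) hs
      _ = 2 ^ s * wt j ^ s := Real.mul_rpow (by norm_num) (wt_pos j).le
      _ ≤ _ := by nlinarith

lemma summable_wt {d : ℕ} {s : ℝ} (hs : (d : ℝ) / 2 < s) :
    Summable (fun j : Fin d → ℤ => wt j ^ (-(2 * s))) := by
  let b := Pi.basisFun ℝ (Fin d)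
  let L := Submodule.span ℤ (Set.range b)
  have hrank : Module.finrank ℤ L = d := by
    rw [ZLattice.rank ℝ L]; simp
  have hsum := ZLattice.summable_norm_rpow L (-(2 * s)) (by rw [hrank]; linarith)
  let e : (Fin d → ℤ) → L := fun j => ⟨fun i => (j i : ℝ), by
    refine (b.mem_span_iff_repr_mem ℤ _).2 ?_
    intro i
    exact ⟨j i, by simp [b]⟩⟩
  have he : Function.Injective e := by
    intro j k h
    funext i
    have := congrFun (congrArg Subtype.val h) i
    simpa [e] using this
  have h2 := hsum.comp_injective he
  have h3 : Summable (fun j : Fin d → ℤ => if j = 0 then (1 : ℝ) else 0) :=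
    (hasSum_ite_eq (0 : Fin d → ℤ) (1 : ℝ)).summable
  have hd0 : (0 : ℝ) ≤ d := Nat.cast_nonneg d
  refine Summable.of_nonneg_of_le (fun j => Real.rpow_nonneg (wt_pos j).le _) (fun j => ?_)
    (h2.add h3)
  by_cases hj : j = 0
  · subst hj
    have : (0:ℝ) ≤ ‖e 0‖ ^ (-(2*s)) := by positivity
    have h4 : wt (0 : Fin d → ℤ) = 1 := by simp [wt, absZ]
    simpa [h4] using this
  · simp only [hj, if_false, add_zero, Function.comp]
    have hne : e j ≠ 0 := by
      intro h
      apply hj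
      apply he
      rw [h]
      ext i
      simp [e]
    have hpos : 0 < ‖e j‖ := norm_pos_iff.2 hne
    apply Real.rpow_le_rpow_of_nonpos hpos _ (by linarith)
    refine le_trans ?_ (le_max_left _ _)
    change ‖(fun i => (j i : ℝ))‖ ≤ absZ j
    rw [pi_norm_le_iff_of_nonneg (absZ_nonneg j)]
    intro i
    exact abs_le_absZ j i

/-- The constant of the embedding into `ℓ¹`. -/
def SW (d : ℕ) (s : ℝ) : ℝ≥0∞ := F2 (fun j : Fin d → ℤ => (W s j)⁻¹)

lemma SW_ne_top {d : ℕ} {s : ℝ} (hs : (d : ℝ) / 2 < s) : SW d s ≠ ⊤ := by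
  have h : ∑' j : Fin d → ℤ, ((W s j)⁻¹) ^ 2 ≠ ⊤ := by
    have := (summable_wt hs).tsum_ofReal_ne_top
    convert this using 3 with j
    unfold W
    rw [← ENNReal.ofReal_inv_of_pos (Real.rpow_pos_of_pos (wt_pos j) s), ← ENNReal.ofReal_pow
      (inv_nonneg.2 (Real.rpow_nonneg (wt_pos j).le s)), ← Real.rpow_neg (wt_pos j).le,
      ← Real.rpow_natCast, ← Real.rpow_mul (wt_pos j).le]
    congr 2
    push_cast
    ring
  unfold SW F2
  exact ENNReal.rpow_ne_top_of_nonneg (by norm_num) h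

/-! ### The extended Sobolev norm -/

/-- Sobolev norm with values in `[0,∞]`. -/
def E {d : ℕ} (s : ℝ) (v : Coef d) : ℝ≥0∞ := F2 (fun j => W s j * ‖v j‖ₑ)

lemma sobNorm_eq {d : ℕ} (s : ℝ) (v : Coef d) : sobNorm s v = (E s v).toReal := by
  unfold sobNorm E F2
  rw [← ENNReal.toReal_rpow, Real.sqrt_eq_rpow, ENNReal.tsum_toReal_eq]
  · congr 2
    ext j
    simp only [ENNReal.toReal_pow, ENNReal.toReal_mul, W, toReal_enorm]
    rw [ENNReal.toReal_ofReal (Real.rpow_nonneg (wt_pos j).le s), mul_pow]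
    congr 1
    rw [← Real.rpow_natCast, ← Real.rpow_mul (wt_pos j).le]
    unfold wt
    congr 1
    push_cast
    ring
  · intro j
    exact ENNReal.pow_ne_top (ENNReal.mul_ne_top (W_ne_top s j) enorm_ne_top)

lemma E_mono_s {d : ℕ} {s r : ℝ} (h : s ≤ r) (v : Coef d) : E s v ≤ E r v := by
  apply F2_mono
  intro j
  gcongr
  exact W_mono h j

lemma E_le_mul {d : ℕ} {s : ℝ} {v w : Coef d} (C : ℝ≥0∞) (h : ∀ j, ‖v j‖ₑ ≤ C * ‖w j‖ₑ) :
    E s v ≤ C * E s w := by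
  unfold E
  rw [← F2_const_mul]
  apply F2_mono
  intro j
  calc W s j * ‖v j‖ₑ ≤ W s j * (C * ‖w j‖ₑ) := by gcongr; exact h j
    _ = _ := by ring

lemma E_smul {d : ℕ} {s : ℝ} (a : ℂ) (v : Coef d) : E s (a • v) ≤ ‖a‖ₑ * E s v :=
  E_le_mul _ (fun j => by simp [enorm_mul])

lemma E_add {d : ℕ} {s : ℝ} (v w : Coef d) : E s (v + w) ≤ E s v + E s w := by
  refine le_trans (F2_mono fun j => ?_) (F2_add _ _)
  rw [← mul_add]
  gcongr
  exact enorm_add_le _ _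

lemma E_neg {d : ℕ} {s : ℝ} (v : Coef d) : E s (-v) = E s v := by
  simp [E]

lemma E_sub {d : ℕ} {s : ℝ} (v w : Coef d) : E s (v - w) ≤ E s v + E s w := by
  rw [sub_eq_add_neg]
  exact (E_add _ _).trans (by rw [E_neg])

lemma E_sum {d : ℕ} {s : ℝ} (f : ℕ → Coef d) (n : ℕ) :
    E s (∑ m ∈ Finset.range n, f m) ≤ ∑ m ∈ Finset.range n, E s (f m) := by
  induction n with
  | zero => simp [E, F2]
  | succ n ih =>
    rw [Finset.sum_range_succ, Finset.sum_range_succ]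
    exact (E_add _ _).trans (by gcongr)

lemma E_conj {d : ℕ} {s : ℝ} (v : Coef d) : E s (conjC v) = E s v := by
  unfold E
  rw [← F2_comp_equiv (Equiv.neg (Fin d → ℤ))]
  congr 1
  ext j
  simp [conjC, W, wt_neg, ← ofReal_norm]

lemma enorm_le_E {d : ℕ} {s : ℝ} (hs : 0 ≤ s) (v : Coef d) (j : Fin d → ℤ) : ‖v j‖ₑ ≤ E s v := by
  refine le_trans ?_ (le_F2 _ j)
  calc ‖v j‖ₑ = 1 * ‖v j‖ₑ := (one_mul _).symm
    _ ≤ _ := by gcongr; exact one_le_W hs j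

lemma l1_le_E {d : ℕ} (s : ℝ) (v : Coef d) : ∑' j, ‖v j‖ₑ ≤ SW d s * E s v := by
  refine le_trans (le_of_eq ?_) (F2_cs _ _)
  congr 1
  ext j
  rw [← mul_assoc, ENNReal.inv_mul_cancel (W_ne_zero s j) (W_ne_top s j), one_mul]

lemma summable_norm_of_E {d : ℕ} {s : ℝ} (hs : (d : ℝ) / 2 < s) {v : Coef d} (hv : E s v ≠ ⊤) :
    Summable (fun j => ‖v j‖) := by
  rw [← tsum_enorm_ne_top_iff_summable_norm]
  exact ne_top_of_le_ne_top (ENNReal.mul_ne_top (SW_ne_top hs) hv) (l1_le_E s v)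

/-! ### Convolution -/

lemma young {d : ℕ} (f g : (Fin d → ℤ) → ℝ≥0∞) :
    F2 (fun j => ∑' k, f k * g (j - k)) ≤ (∑' k, f k) * F2 g := by
  refine (F2_tsum _).trans ?_
  rw [← ENNReal.tsum_mul_right]
  gcongr with k
  rw [F2_const_mul]
  exact (congrArg (f k * ·) (F2_comp_equiv (Equiv.subRight k) g)).le

lemma young' {d : ℕ} (f g : (Fin d → ℤ) → ℝ≥0∞) :
    F2 (fun j => ∑' k, f k * g (j - k)) ≤ (∑' k, g k) * F2 f := by
  refine le_trans (le_of_eq ?_) (young g f)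
  congr 1
  ext j
  rw [← (Equiv.subLeft j).tsum_eq]
  congr 1
  ext k
  simp [mul_comm]

/-- The algebra constant. -/
def cA (d : ℕ) (s : ℝ) : ℝ≥0∞ := ENNReal.ofReal (2 ^ s) * (2 * SW d s)

lemma cA_ne_top {d : ℕ} {s : ℝ} (hs : (d : ℝ) / 2 < s) : cA d s ≠ ⊤ :=
  ENNReal.mul_ne_top ENNReal.ofReal_ne_top (ENNReal.mul_ne_top (by simp) (SW_ne_top hs))

lemma E_conv {d : ℕ} {s : ℝ} (hs : 0 ≤ s) (v w : Coef d) :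
    E s (conv v w) ≤ cA d s * (E s v * E s w) := by
  have h1 : ∀ j, W s j * ‖conv v w j‖ₑ ≤ ENNReal.ofReal (2 ^ s) *
      ((∑' k, (W s k * ‖v k‖ₑ) * ‖w (j - k)‖ₑ) + ∑' k, ‖v k‖ₑ * (W s (j - k) * ‖w (j - k)‖ₑ)) := by
    intro j
    rw [← ENNReal.tsum_add, ← ENNReal.tsum_mul_left]
    calc W s j * ‖conv v w j‖ₑ ≤ W s j * ∑' k, ‖v k * w (j - k)‖ₑ := by
          gcongr; exact enorm_tsum_le_tsum_enorm
      _ = ∑' k, W s j * ‖v k * w (j - k)‖ₑ := by rw [ENNReal.tsum_mul_left]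
      _ ≤ _ := by
        refine ENNReal.tsum_le_tsum fun k => ?_
        have h := W_add_le hs k (j - k)
        rw [add_sub_cancel] at h
        calc W s j * ‖v k * w (j - k)‖ₑ
            ≤ (ENNReal.ofReal (2 ^ s) * (W s k + W s (j - k))) * ‖v k * w (j - k)‖ₑ := by gcongr
          _ = _ := by rw [enorm_mul]; ring
  refine (F2_mono h1).trans ?_
  rw [F2_const_mul]
  have h2 := (F2_add (fun j => ∑' k, (W s k * ‖v k‖ₑ) * ‖w (j - k)‖ₑ)
    (fun j => ∑' k, ‖v k‖ₑ * (W s (j - k) * ‖w (j - k)‖ₑ))).trans (add_le_add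
      (young' (fun k => W s k * ‖v k‖ₑ) (fun k => ‖w k‖ₑ))
      (young (fun k => ‖v k‖ₑ) (fun k => W s k * ‖w k‖ₑ)))
  calc _ ≤ ENNReal.ofReal (2 ^ s) * ((∑' k, ‖w k‖ₑ) * E s v + (∑' k, ‖v k‖ₑ) * E s w) := by
        gcongr; exact h2
    _ ≤ ENNReal.ofReal (2 ^ s) * ((SW d s * E s w) * E s v + (SW d s * E s v) * E s w) := by
        gcongr <;> exact l1_le_E _ _
    _ = _ := by unfold cA; ring

lemma summable_conv {d : ℕ} {s : ℝ} (hs : (d : ℝ) / 2 < s) {v w : Coef d} (hv : E s v ≠ ⊤)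
    (hw : E s w ≠ ⊤) (j : Fin d → ℤ) : Summable (fun k => v k * w (j - k)) := by
  have hs0 : 0 ≤ s := le_trans (by positivity) hs.le
  rw [← summable_norm_iff, ← tsum_enorm_ne_top_iff_summable_norm]
  have : ∑' k, ‖v k * w (j - k)‖ₑ ≤ (SW d s * E s v) * E s w := by
    calc ∑' k, ‖v k * w (j - k)‖ₑ ≤ ∑' k, ‖v k‖ₑ * E s w := by
          gcongr with k; rw [enorm_mul]; gcongr; exact enorm_le_E hs0 _ _
      _ ≤ _ := by rw [ENNReal.tsum_mul_right]; gcongr; exact l1_le_E _ _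
  exact ne_top_of_le_ne_top (ENNReal.mul_ne_top (ENNReal.mul_ne_top (SW_ne_top hs) hv) hw) this

lemma conv_sub_left {d : ℕ} {s : ℝ} (hs : (d : ℝ) / 2 < s) {v v' w : Coef d} (hv : E s v ≠ ⊤)
    (hv' : E s v' ≠ ⊤) (hw : E s w ≠ ⊤) : conv (v - v') w = conv v w - conv v' w := by
  ext j
  simp only [conv, Pi.sub_apply]
  rw [← (summable_conv hs hv hw j).tsum_sub (summable_conv hs hv' hw j)]
  congr 1
  ext k
  ring

lemma conv_sub_right {d : ℕ} {s : ℝ} (hs : (d : ℝ) / 2 < s) {v w w' : Coef d} (hv : E s v ≠ ⊤)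
    (hw : E s w ≠ ⊤) (hw' : E s w' ≠ ⊤) : conv v (w - w') = conv v w - conv v w' := by
  ext j
  simp only [conv, Pi.sub_apply]
  rw [← (summable_conv hs hv hw j).tsum_sub (summable_conv hs hv hw' j)]
  congr 1
  ext k
  ring

/-- Lipschitz estimate for products. -/
lemma E_conv_sub {d : ℕ} {s : ℝ} (hs : (d : ℝ) / 2 < s) {v v' w w' : Coef d} (hv : E s v ≠ ⊤)
    (hv' : E s v' ≠ ⊤) (hw : E s w ≠ ⊤) (hw' : E s w' ≠ ⊤) :
    E s (conv v w - conv v' w') ≤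
      cA d s * (E s (v - v') * E s w) + cA d s * (E s v' * E s (w - w')) := by
  have hs0 : 0 ≤ s := le_trans (by positivity) hs.le
  have h : conv v w - conv v' w' = conv (v - v') w + conv v' (w - w') := by
    rw [conv_sub_left hs hv hv' hw, conv_sub_right hs hv' hw hw']; abel
  rw [h]
  exact (E_add _ _).trans (add_le_add (E_conv hs0 _ _) (E_conv hs0 _ _))

/-! ### Interpolation -/

lemma absZ_le_of {d : ℕ} (j : Fin d → ℤ) (B : ℝ) (h : ∀ i, |(j i : ℝ)| ≤ B) :
    absZ j ^ 2 ≤ d * B ^ 2 := by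
  rw [absZ_sq]
  calc ∑ i, ((j i : ℝ)) ^ 2 ≤ ∑ _i : Fin d, B ^ 2 := by
        apply Finset.sum_le_sum
        intro i _
        rw [← sq_abs]
        have := h i
        have h0 := abs_nonneg (j i : ℝ)
        gcongr
    _ = _ := by simp

lemma abs_le_of_inK {d K : ℕ} {j : Fin d → ℤ} (hj : inK d K j) (i : Fin d) :
    |(j i : ℝ)| ≤ K := by
  have h := hj i
  rw [abs_le]
  constructor
  · exact_mod_cast h.1
  · exact_mod_cast h.2.le

lemma wt_le_of {d : ℕ} (hd : 1 ≤ d) (j : Fin d → ℤ) (B : ℝ) (hB : 1 ≤ B)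
    (h : ∀ i, |(j i : ℝ)| ≤ B) : wt j ≤ Real.sqrt d * B := by
  have hd1 : (1 : ℝ) ≤ d := by exact_mod_cast hd
  have hsq : 1 ≤ Real.sqrt d := Real.one_le_sqrt.2 hd1
  apply max_le
  · have h1 : absZ j ^ 2 ≤ (Real.sqrt d * B) ^ 2 := by
      rw [mul_pow, Real.sq_sqrt (by linarith)]
      exact absZ_le_of j B h
    exact (abs_le_of_sq_le_sq' h1 (by positivity)).2
  · nlinarith

lemma wt_alias {d K : ℕ} (hd : 1 ≤ d) (hK : 1 ≤ K) {j : Fin d → ℤ} (hj : inK d K j)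
    (m : Fin d → ℤ) : wt j * wt m ≤ d * wt (j + (2 * (K : ℤ)) • m) := by
  have hd1 : (1 : ℝ) ≤ d := by exact_mod_cast hd
  have hK1 : (1 : ℝ) ≤ K := by exact_mod_cast hK
  by_cases hm : m = 0
  · subst hm
    have h4 : wt (0 : Fin d → ℤ) = 1 := by simp [wt, absZ]
    rw [h4, smul_zero, add_zero, mul_one]
    nlinarith [wt_pos j]
  · have : Nonempty (Fin d) := ⟨⟨0, hd⟩⟩
    obtain ⟨i, hi⟩ := Finite.exists_max (fun i => |(m i : ℝ)|)
    have hmi : 1 ≤ |(m i : ℝ)| := by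
      have : m i ≠ 0 := by
        intro h0
        apply hm
        funext k
        have := hi k
        rw [h0] at this
        simpa using this
      have h1 : 1 ≤ |m i| := Int.one_le_abs this
      exact_mod_cast h1
    have h1 : wt j ≤ Real.sqrt d * K := wt_le_of hd j K hK1 (abs_le_of_inK hj)
    have h2 : wt m ≤ Real.sqrt d * |(m i : ℝ)| := wt_le_of hd m _ hmi hi
    have h3 : (K : ℝ) * |(m i : ℝ)| ≤ wt (j + (2 * (K : ℤ)) • m) := by
      refine le_trans ?_ ((abs_le_absZ _ i).trans (le_max_left _ _))
      have h5 := abs_le_of_inK hj i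
      have h6 : |2 * (K : ℝ) * m i| = 2 * K * |(m i : ℝ)| := by
        rw [abs_mul, abs_of_nonneg (by positivity)]
      have h7 := abs_sub_abs_le_abs_sub (2 * (K : ℝ) * m i) (-(j i : ℝ))
      rw [h6, abs_neg] at h7
      have h8 : (((j + (2 * (K : ℤ)) • m) i : ℤ) : ℝ) = 2 * (K : ℝ) * m i - (-(j i : ℝ)) := by
        simp; ring
      rw [h8]
      nlinarith
    calc wt j * wt m ≤ (Real.sqrt d * K) * (Real.sqrt d * |(m i : ℝ)|) :=
          mul_le_mul h1 h2 (wt_pos m).le (by positivity)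
      _ = (Real.sqrt d * Real.sqrt d) * (K * |(m i : ℝ)|) := by ring
      _ = d * (K * |(m i : ℝ)|) := by rw [Real.mul_self_sqrt (by linarith)]
      _ ≤ _ := by gcongr

lemma W_alias {d K : ℕ} (hd : 1 ≤ d) (hK : 1 ≤ K) {s : ℝ} (hs : 0 ≤ s) {j : Fin d → ℤ}
    (hj : inK d K j) (m : Fin d → ℤ) :
    W s j ≤ ENNReal.ofReal ((d : ℝ) ^ s) * ((W s m)⁻¹ * W s (j + (2 * (K : ℤ)) • m)) := by
  have h : W s j * W s m ≤ ENNReal.ofReal ((d : ℝ) ^ s) * W s (j + (2 * (K : ℤ)) • m) := by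
    unfold W
    rw [← ENNReal.ofReal_mul (Real.rpow_nonneg (wt_pos j).le s),
      ← ENNReal.ofReal_mul (by positivity)]
    apply ENNReal.ofReal_le_ofReal
    rw [← Real.mul_rpow (wt_pos _).le (wt_pos _).le, ← Real.mul_rpow (by positivity) (wt_pos _).le]
    exact Real.rpow_le_rpow (mul_pos (wt_pos _) (wt_pos _)).le (wt_alias hd hK hj m) hs
  calc W s j = (W s j * W s m) * (W s m)⁻¹ := by
        rw [mul_assoc, ENNReal.mul_inv_cancel (W_ne_zero s m) (W_ne_top s m), mul_one]
    _ ≤ (ENNReal.ofReal ((d : ℝ) ^ s) * W s (j + (2 * (K : ℤ)) • m)) * (W s m)⁻¹ := by gcongr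
    _ = _ := by ring

lemma not_inK_zero {d : ℕ} (hd : 1 ≤ d) (j : Fin d → ℤ) : ¬ inK d 0 j := by
  intro h
  have := h ⟨0, hd⟩
  simp at this
  omega

/-- The interpolation constant. -/
def cI (d : ℕ) (s : ℝ) : ℝ≥0∞ := ENNReal.ofReal ((d : ℝ) ^ s) * SW d s

lemma cI_ne_top {d : ℕ} {s : ℝ} (hs : (d : ℝ) / 2 < s) : cI d s ≠ ⊤ :=
  ENNReal.mul_ne_top ENNReal.ofReal_ne_top (SW_ne_top hs)

lemma alias_injective {d K : ℕ} (hK : 1 ≤ K) :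
    Function.Injective (fun p : {j : Fin d → ℤ // inK d K j} × (Fin d → ℤ) =>
      p.1.1 + (2 * (K : ℤ)) • p.2) := by
  rintro ⟨⟨j, hj⟩, m⟩ ⟨⟨j', hj'⟩, m'⟩ h
  have hm : m = m' := by
    funext i
    have h1 := congrFun h i
    have h2 := hj i
    have h3 := hj' i
    simp only [Pi.add_apply, Pi.smul_apply, smul_eq_mul] at h1
    have hK' : (1 : ℤ) ≤ K := by exact_mod_cast hK
    by_contra hne
    rcases lt_or_gt_of_ne hne with h4 | h4
    · nlinarith
    · nlinarith
  subst hm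
  have : j = j' := by
    simpa using h
  subst this
  rfl

lemma E_interp {d K : ℕ} (hd : 1 ≤ d) {s : ℝ} (hs : 0 ≤ s) (v : Coef d) :
    E s (interp d K v) ≤ cI d s * E s v := by
  rcases Nat.eq_zero_or_pos K with hK | hK
  · subst hK
    have : interp d 0 v = 0 := by
      funext j
      simp [interp, not_inK_zero hd]
    simp [this, E, F2]
  have hpt : ∀ j : {j : Fin d → ℤ // inK d K j}, W s j.1 * ‖interp d K v j.1‖ₑ ≤
      cI d s * F2 (fun m => W s (j.1 + (2 * (K : ℤ)) • m) * ‖v (j.1 + (2 * (K : ℤ)) • m)‖ₑ) := by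
    rintro ⟨j, hj⟩
    simp only [interp, if_pos hj]
    calc W s j * ‖∑' m : Fin d → ℤ, v (j + (2 * (K : ℤ)) • m)‖ₑ
        ≤ W s j * ∑' m : Fin d → ℤ, ‖v (j + (2 * (K : ℤ)) • m)‖ₑ := by
          gcongr; exact enorm_tsum_le_tsum_enorm
      _ = ∑' m : Fin d → ℤ, W s j * ‖v (j + (2 * (K : ℤ)) • m)‖ₑ := by rw [ENNReal.tsum_mul_left]
      _ ≤ ∑' m : Fin d → ℤ, ENNReal.ofReal ((d : ℝ) ^ s) * ((W s m)⁻¹ *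
            (W s (j + (2 * (K : ℤ)) • m) * ‖v (j + (2 * (K : ℤ)) • m)‖ₑ)) := by
          refine ENNReal.tsum_le_tsum fun m => ?_
          refine (mul_le_mul_left (W_alias hd hK hs hj m) _).trans (le_of_eq ?_)
          ring
      _ ≤ _ := by
          rw [ENNReal.tsum_mul_left, cI, mul_assoc]
          gcongr
          exact F2_cs _ _
  apply le_of_sq_le
  rw [mul_pow, E, F2_sq, E, F2_sq]
  have hsub : ∑' j, (W s j * ‖interp d K v j‖ₑ) ^ 2
      = ∑' j : {j : Fin d → ℤ // inK d K j}, (W s j.1 * ‖interp d K v j.1‖ₑ) ^ 2 := by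
    symm
    apply tsum_subtype_eq_of_support_subset (s := {j : Fin d → ℤ | inK d K j})
      (f := fun j => (W s j * ‖interp d K v j‖ₑ) ^ 2)
    intro j hj
    by_contra hn
    apply hj
    have : ¬ inK d K j := hn
    simp [interp, this]
  rw [hsub]
  calc _ ≤ ∑' j : {j : Fin d → ℤ // inK d K j}, (cI d s * F2 (fun m =>
        W s (j.1 + (2 * (K : ℤ)) • m) * ‖v (j.1 + (2 * (K : ℤ)) • m)‖ₑ)) ^ 2 := by
        refine ENNReal.tsum_le_tsum fun j => ?_
        exact pow_le_pow_left' (hpt j) 2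
    _ = cI d s ^ 2 * ∑' j : {j : Fin d → ℤ // inK d K j}, ∑' m,
        (W s (j.1 + (2 * (K : ℤ)) • m) * ‖v (j.1 + (2 * (K : ℤ)) • m)‖ₑ) ^ 2 := by
        simp only [mul_pow, F2_sq, ENNReal.tsum_mul_left]
    _ ≤ _ := by
        gcongr
        rw [← ENNReal.tsum_prod (f := fun (j : {j : Fin d → ℤ // inK d K j}) (m : Fin d → ℤ) =>
          (W s (j.1 + (2 * (K : ℤ)) • m) * ‖v (j.1 + (2 * (K : ℤ)) • m)‖ₑ) ^ 2)]
        exact ENNReal.tsum_comp_le_tsum_of_injective (alias_injective hK)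
          (fun j => (W s j * ‖v j‖ₑ) ^ 2)

lemma interp_sub {d K : ℕ} (hd : 1 ≤ d) {s : ℝ} (hs : (d : ℝ) / 2 < s) {v w : Coef d}
    (hv : E s v ≠ ⊤) (hw : E s w ≠ ⊤) :
    interp d K (v - w) = interp d K v - interp d K w := by
  rcases Nat.eq_zero_or_pos K with hK | hK
  · subst hK
    funext j
    simp [interp, not_inK_zero hd]
  funext j
  by_cases hj : inK d K j
  · simp only [interp, if_pos hj, Pi.sub_apply]
    have hinj : Function.Injective (fun m : Fin d → ℤ => j + (2 * (K : ℤ)) • m) := by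
      intro m m' h
      have := alias_injective (d := d) hK (a₁ := (⟨j, hj⟩, m)) (a₂ := (⟨j, hj⟩, m')) h
      simpa using this
    have h1 : Summable (fun m : Fin d → ℤ => v (j + (2 * (K : ℤ)) • m)) :=
      (summable_norm_of_E hs hv).of_norm.comp_injective hinj
    have h2 : Summable (fun m : Fin d → ℤ => w (j + (2 * (K : ℤ)) • m)) :=
      (summable_norm_of_E hs hw).of_norm.comp_injective hinj
    exact h1.tsum_sub h2
  · simp [interp, hj]

lemma isTrig_interp {d K : ℕ} (v : Coef d) : isTrig d K (interp d K v) := by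
  intro j hj
  simp [interp, hj]

lemma inK_finite (d K : ℕ) : {j : Fin d → ℤ | inK d K j}.Finite := by
  apply (Set.finite_Icc (fun _ : Fin d => -(K : ℤ)) (fun _ => (K : ℤ))).subset
  intro j hj
  exact ⟨fun i => (hj i).1, fun i => (hj i).2.le⟩

lemma E_ne_top_of_isTrig {d K : ℕ} (s : ℝ) {v : Coef d} (h : isTrig d K v) : E s v ≠ ⊤ := by
  unfold E F2
  apply ENNReal.rpow_ne_top_of_nonneg (by norm_num)
  have hf := inK_finite d K
  rw [tsum_eq_sum (s := hf.toFinset)]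
  · rw [ENNReal.sum_ne_top]
    intro j _
    exact ENNReal.pow_ne_top (ENNReal.mul_ne_top (W_ne_top s j) enorm_ne_top)
  · intro j hj
    have : ¬ inK d K j := by simpa using hj
    simp [h j this]

/-! ### Exponential type series -/

/-- Extended exponential series. -/
def expQ (Q : ℝ≥0∞) : ℝ≥0∞ := ∑' n : ℕ, ((n.factorial : ℝ≥0∞))⁻¹ * Q ^ n

lemma expQ_ne_top {Q : ℝ≥0∞} (hQ : Q ≠ ⊤) : expQ Q ≠ ⊤ := by
  have h := (Real.summable_pow_div_factorial Q.toReal).tsum_ofReal_ne_top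
  unfold expQ
  convert h using 3 with n
  rw [div_eq_inv_mul, ENNReal.ofReal_mul (by positivity), ENNReal.ofReal_pow (by positivity),
    ENNReal.ofReal_toReal hQ, ENNReal.ofReal_inv_of_pos (by positivity), ENNReal.ofReal_natCast]

lemma E_tsum {d : ℕ} {s : ℝ} (f : ℕ → Coef d) :
    E s (fun j => ∑' n, f n j) ≤ ∑' n, E s (f n) := by
  refine le_trans (F2_mono fun j => ?_) (F2_tsum _)
  rw [ENNReal.tsum_mul_left]
  gcongr
  exact enorm_tsum_le_tsum_enorm

lemma E_delta {d : ℕ} (s : ℝ) : E s (fun j : Fin d → ℤ => if j = 0 then (1 : ℂ) else 0) ≤ 1 := by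
  apply le_of_sq_le
  rw [E, F2_sq, tsum_eq_single 0]
  · have h4 : wt (0 : Fin d → ℤ) = 1 := by simp [wt, absZ]
    simp [W, h4]
  · intro j hj
    simp [hj]

lemma E_convPow {d : ℕ} {s : ℝ} (hs : 0 ≤ s) (a : Coef d) {Q : ℝ≥0∞} (hQ : cA d s * E s a ≤ Q)
    (n : ℕ) : E s (convPow a n) ≤ Q ^ n := by
  induction n with
  | zero => simpa [convPow] using E_delta s
  | succ n ih =>
    calc E s (convPow a (n + 1)) ≤ cA d s * (E s a * E s (convPow a n)) := E_conv hs _ _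
      _ = (cA d s * E s a) * E s (convPow a n) := by ring
      _ ≤ Q * Q ^ n := by gcongr
      _ = _ := by ring

lemma E_convPow_sub {d : ℕ} {s : ℝ} (hs : (d : ℝ) / 2 < s) (a b : Coef d) {Q : ℝ≥0∞}
    (hQ1 : 1 ≤ Q) (hQt : Q ≠ ⊤) (ha : cA d s * E s a ≤ Q) (hb : cA d s * E s b ≤ Q)
    (hat : E s a ≠ ⊤) (hbt : E s b ≠ ⊤) (n : ℕ) :
    E s (convPow a n - convPow b n) ≤ n * Q ^ n * (cA d s * E s (a - b)) := by
  have hs0 : 0 ≤ s := le_trans (by positivity) hs.le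
  have hpa : ∀ n, E s (convPow a n) ≠ ⊤ := fun n =>
    ne_top_of_le_ne_top (ENNReal.pow_ne_top hQt) (E_convPow hs0 a ha n)
  have hpb : ∀ n, E s (convPow b n) ≠ ⊤ := fun n =>
    ne_top_of_le_ne_top (ENNReal.pow_ne_top hQt) (E_convPow hs0 b hb n)
  induction n with
  | zero => simp [convPow, E, F2]
  | succ n ih =>
    calc E s (convPow a (n + 1) - convPow b (n + 1))
        ≤ cA d s * (E s (a - b) * E s (convPow a n))
          + cA d s * (E s b * E s (convPow a n - convPow b n)) :=
          E_conv_sub hs hat hbt (hpa n) (hpb n)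
      _ = (cA d s * E s (a - b)) * E s (convPow a n)
          + (cA d s * E s b) * E s (convPow a n - convPow b n) := by ring
      _ ≤ (cA d s * E s (a - b)) * (Q ^ n * Q)
          + Q * (n * Q ^ n * (cA d s * E s (a - b))) := by
          gcongr
          calc E s (convPow a n) ≤ Q ^ n * 1 := by rw [mul_one]; exact E_convPow hs0 a ha n
            _ ≤ _ := by gcongr
      _ = _ := by push_cast; ring

lemma enorm_coef_le (n : ℕ) :
    ‖((((n + 1).factorial : ℕ) : ℂ))⁻¹‖ₑ = (((n + 1).factorial : ℕ) : ℝ≥0∞)⁻¹ := by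
  rw [enorm_inv (by exact_mod_cast (n + 1).factorial_ne_zero)]
  congr 1
  rw [← ofReal_norm]
  simp

lemma coef_le (n : ℕ) : (((n + 1).factorial : ℕ) : ℝ≥0∞)⁻¹ ≤ ((n.factorial : ℕ) : ℝ≥0∞)⁻¹ := by
  apply ENNReal.inv_le_inv.2
  exact_mod_cast Nat.factorial_le (Nat.le_succ n)

lemma coef_mul_le (n : ℕ) :
    (((n + 1).factorial : ℕ) : ℝ≥0∞)⁻¹ * n ≤ ((n.factorial : ℕ) : ℝ≥0∞)⁻¹ := by
  have h : (((n + 1).factorial : ℕ) : ℝ≥0∞)⁻¹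
      = ((n + 1 : ℕ) : ℝ≥0∞)⁻¹ * ((n.factorial : ℕ) : ℝ≥0∞)⁻¹ := by
    rw [Nat.factorial_succ, Nat.cast_mul, ENNReal.mul_inv] <;> simp
  rw [h]
  calc ((n + 1 : ℕ) : ℝ≥0∞)⁻¹ * ((n.factorial : ℕ) : ℝ≥0∞)⁻¹ * n
      ≤ ((n + 1 : ℕ) : ℝ≥0∞)⁻¹ * ((n.factorial : ℕ) : ℝ≥0∞)⁻¹ * (n + 1 : ℕ) := by
        gcongr; exact Nat.le_succ n
    _ = (((n + 1 : ℕ) : ℝ≥0∞)⁻¹ * (n + 1 : ℕ)) * ((n.factorial : ℕ) : ℝ≥0∞)⁻¹ := by ring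
    _ = _ := by rw [ENNReal.inv_mul_cancel (by simp) (by simp), one_mul]

lemma E_phiC {d : ℕ} {s : ℝ} (hs : 0 ≤ s) (a : Coef d) {Q : ℝ≥0∞} (hQ : cA d s * E s a ≤ Q) :
    E s (phiC a) ≤ expQ Q := by
  refine (E_tsum (fun n => ((((n + 1).factorial : ℕ) : ℂ))⁻¹ • convPow a n)).trans ?_
  refine ENNReal.tsum_le_tsum fun n => ?_
  refine (E_smul _ _).trans ?_
  rw [enorm_coef_le]
  gcongr
  · exact Nat.le_succ n
  · exact E_convPow hs a hQ n

lemma summable_phiC {d : ℕ} {s : ℝ} (hs : 0 ≤ s) (a : Coef d) {Q : ℝ≥0∞} (hQt : Q ≠ ⊤)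
    (hQ : cA d s * E s a ≤ Q) (j : Fin d → ℤ) :
    Summable (fun n : ℕ => ((((n + 1).factorial : ℕ) : ℂ))⁻¹ * convPow a n j) := by
  rw [← summable_norm_iff, ← tsum_enorm_ne_top_iff_summable_norm]
  refine ne_top_of_le_ne_top (expQ_ne_top hQt) (ENNReal.tsum_le_tsum fun n => ?_)
  rw [enorm_mul, enorm_coef_le]
  gcongr
  · exact Nat.le_succ n
  · exact (enorm_le_E hs _ j).trans (E_convPow hs a hQ n)

lemma E_phiC_sub {d : ℕ} {s : ℝ} (hs : (d : ℝ) / 2 < s) (a b : Coef d) {Q : ℝ≥0∞}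
    (hQ1 : 1 ≤ Q) (hQt : Q ≠ ⊤) (ha : cA d s * E s a ≤ Q) (hb : cA d s * E s b ≤ Q)
    (hat : E s a ≠ ⊤) (hbt : E s b ≠ ⊤) :
    E s (phiC a - phiC b) ≤ expQ Q * (cA d s * E s (a - b)) := by
  have hs0 : 0 ≤ s := le_trans (by positivity) hs.le
  have h : phiC a - phiC b = fun j => ∑' n : ℕ,
      (((((n + 1).factorial : ℕ) : ℂ))⁻¹ • (convPow a n - convPow b n)) j := by
    funext j
    simp only [phiC, Pi.sub_apply, Pi.smul_apply, smul_eq_mul, mul_sub]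
    rw [(summable_phiC hs0 a hQt ha j).tsum_sub (summable_phiC hs0 b hQt hb j)]
  rw [h]
  refine (E_tsum (fun n => ((((n + 1).factorial : ℕ) : ℂ))⁻¹ • (convPow a n - convPow b n))).trans ?_
  rw [expQ, ← ENNReal.tsum_mul_right]
  refine ENNReal.tsum_le_tsum fun n => ?_
  refine (E_smul _ _).trans ?_
  rw [enorm_coef_le]
  calc _ ≤ (((n + 1).factorial : ℕ) : ℝ≥0∞)⁻¹ * (n * Q ^ n * (cA d s * E s (a - b))) := by
        gcongr; exact E_convPow_sub hs a b hQ1 hQt ha hb hat hbt n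
    _ = ((((n + 1).factorial : ℕ) : ℝ≥0∞)⁻¹ * n) * (Q ^ n * (cA d s * E s (a - b))) := by ring
    _ ≤ ((n.factorial : ℕ) : ℝ≥0∞)⁻¹ * (Q ^ n * (cA d s * E s (a - b))) := by
        gcongr; exact coef_mul_le n
    _ = _ := by ring

/-! ### The inverse discrete Poisson operator -/

lemma symbol_lower (c : ℝ) (hc : c < 2 * Real.pi) :
    ∃ δ : ℝ, 0 < δ ∧ ∀ θ τ : ℝ, 0 < τ → 0 ≤ θ → θ ≤ c → (τ ≤ θ ∨ θ = 0) →
      δ * max θ τ ≤ ‖Complex.exp (Complex.I * (θ : ℂ)) - 1 + Complex.I * (τ : ℂ)‖ := by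
  have hpi := Real.pi_pos
  have hpi3 := Real.pi_gt_three
  set c' := max c Real.pi with hc'
  have hc'2 : c' < 2 * Real.pi := max_lt hc (by linarith)
  have hc'pi : Real.pi ≤ c' := le_max_right _ _
  have hcc : c ≤ c' := le_max_left _ _
  set S := Real.sin (c' / 2) with hS
  have hSpos : 0 < S := Real.sin_pos_of_pos_of_lt_pi (by linarith) (by linarith)
  have hS1 : S ≤ 1 := Real.sin_le_one _
  have hδ : S ^ 2 / Real.pi ≤ 1 / Real.pi := by
    gcongr
    nlinarith
  have hδ1 : 1 / Real.pi ≤ 1 := by rw [div_le_one hpi]; linarith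
  refine ⟨S ^ 2 / Real.pi, by positivity, ?_⟩
  intro θ τ hτ hθ hθc hor
  have hz : Complex.exp (Complex.I * (θ : ℂ)) - 1 + Complex.I * (τ : ℂ)
      = ((Real.cos θ - 1 : ℝ) : ℂ) + ((Real.sin θ + τ : ℝ) : ℂ) * Complex.I := by
    rw [mul_comm, Complex.exp_mul_I]
    push_cast
    ring
  have hre : (Complex.exp (Complex.I * (θ : ℂ)) - 1 + Complex.I * (τ : ℂ)).re = Real.cos θ - 1 := by
    rw [hz]; simp [-Complex.ofReal_cos, -Complex.ofReal_sin, -Complex.ofReal_sub,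
      -Complex.ofReal_add]
  have hnorm : ‖Complex.exp (Complex.I * (θ : ℂ)) - 1 + Complex.I * (τ : ℂ)‖
      = Real.sqrt ((Real.cos θ - 1) ^ 2 + (Real.sin θ + τ) ^ 2) := by
    rw [hz, Complex.norm_add_mul_I]
  have hcos : Real.cos θ = 1 - 2 * Real.sin (θ / 2) ^ 2 := by
    have h1 := Real.cos_two_mul (θ / 2)
    have h2 := Real.sin_sq_add_cos_sq (θ / 2)
    rw [mul_div_cancel₀ θ two_ne_zero] at h1
    linarith
  rcases hor with h | h
  · rw [max_eq_left h]
    rcases le_total θ Real.pi with hp | hp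
    · rw [hnorm]
      apply Real.le_sqrt_of_sq_le
      have hs0 : 0 ≤ Real.sin θ := Real.sin_nonneg_of_nonneg_of_le_pi hθ hp
      have h2 := Real.sin_sq_add_cos_sq θ
      have h3 : 2 / Real.pi * (θ / 2) ≤ Real.sin (θ / 2) :=
        Real.mul_le_sin (by linarith) (by linarith)
      have h4 : S ^ 2 / Real.pi * θ ≤ Real.sin (θ / 2) := by
        refine le_trans ?_ h3
        calc S ^ 2 / Real.pi * θ ≤ 1 / Real.pi * θ := by gcongr
          _ = _ := by ring
      have h5 : (S ^ 2 / Real.pi * θ) ^ 2 ≤ Real.sin (θ / 2) ^ 2 := by gcongr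
      nlinarith [sq_nonneg (Real.sin (θ / 2)), mul_nonneg hs0 hτ.le]
    · refine le_trans ?_ (Complex.abs_re_le_norm _)
      rw [hre, hcos]
      have h6 : S ≤ Real.sin (θ / 2) := by
        rw [hS, ← Real.sin_pi_sub (c' / 2), ← Real.sin_pi_sub (θ / 2)]
        apply Real.sin_le_sin_of_le_of_le_pi_div_two <;> linarith
      have h7 : S ^ 2 ≤ Real.sin (θ / 2) ^ 2 := by gcongr
      have h8 : S ^ 2 / Real.pi * θ ≤ 2 * S ^ 2 := by
        calc S ^ 2 / Real.pi * θ ≤ S ^ 2 / Real.pi * (2 * Real.pi) := by gcongr; linarith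
          _ = _ := by field_simp
      have h9 : 1 - 2 * Real.sin (θ / 2) ^ 2 - 1 = -(2 * Real.sin (θ / 2) ^ 2) := by ring
      rw [h9, abs_neg, abs_of_nonneg (by positivity)]
      linarith
  · subst h
    rw [max_eq_right hτ.le]
    simp only [Complex.ofReal_zero, mul_zero, Complex.exp_zero, sub_self, zero_add]
    rw [norm_mul, Complex.norm_I, one_mul, Complex.norm_real, Real.norm_of_nonneg hτ.le]
    calc S ^ 2 / Real.pi * τ ≤ 1 * τ := by gcongr; linarith
      _ = τ := one_mul _

lemma one_le_absZ {d : ℕ} {j : Fin d → ℤ} (hj : j ≠ 0) : 1 ≤ absZ j := by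
  obtain ⟨i, hi⟩ := Function.ne_iff.1 hj
  have h1 : 1 ≤ |j i| := Int.one_le_abs hi
  refine le_trans ?_ (abs_le_absZ j i)
  exact_mod_cast h1

lemma poisson_bound {d : ℕ} (s c : ℝ) (hc : c < 2 * Real.pi) :
    ∃ P : ℝ≥0∞, P ≠ ⊤ ∧ ∀ (K : ℕ) (τ : ℝ), 0 < τ → CFL d K τ c → ∀ v : Coef d, isTrig d K v →
      E (s + 2) (poissonInv d τ v) ≤ P * E s v := by
  obtain ⟨δ, hδ, hlow⟩ := symbol_lower c hc
  refine ⟨ENNReal.ofReal δ⁻¹, ENNReal.ofReal_ne_top, ?_⟩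
  intro K τ hτ hcfl v hv
  unfold E
  rw [← F2_const_mul]
  apply F2_mono
  intro j
  by_cases hj : inK d K j
  swap
  · simp [poissonInv, hv j hj]
  have hθ : τ * absZ j ^ 2 ≤ c := by
    have h1 := absZ_le_of j K (abs_le_of_inK hj)
    calc τ * absZ j ^ 2 ≤ τ * (d * (K : ℝ) ^ 2) := by gcongr
      _ = (d : ℝ) * τ * (K : ℝ) ^ 2 := by ring
      _ ≤ c := hcfl
  have h := hlow (τ * absZ j ^ 2) τ hτ (by positivity) hθ (by
    by_cases h0 : j = 0
    · right; subst h0; simp [absZ]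
    · left
      have h1 := one_le_absZ h0
      have h2 : 1 ≤ absZ j ^ 2 := by nlinarith
      nlinarith)
  have hmax : max (τ * absZ j ^ 2) τ = τ * wt j ^ 2 := by
    unfold wt
    rcases le_total (absZ j) 1 with h1 | h1
    · rw [max_eq_right h1, max_eq_right]
      · ring
      · have : absZ j ^ 2 ≤ 1 := by nlinarith [absZ_nonneg j]
        nlinarith
    · rw [max_eq_left h1, max_eq_left]
      have : 1 ≤ absZ j ^ 2 := by nlinarith
      nlinarith
  rw [hmax] at h
  have hzeq : Complex.exp (Complex.I * (τ : ℂ) * ((absZ j : ℝ) : ℂ) ^ 2) - 1 + Complex.I * (τ : ℂ)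
      = Complex.exp (Complex.I * ((τ * absZ j ^ 2 : ℝ) : ℂ)) - 1 + Complex.I * (τ : ℂ) := by
    push_cast
    rw [mul_assoc]
  rw [← hzeq] at h
  set z := Complex.exp (Complex.I * (τ : ℂ) * ((absZ j : ℝ) : ℂ) ^ 2) - 1 + Complex.I * (τ : ℂ)
    with hz
  have hw := wt_pos j
  have hzpos : 0 < ‖z‖ := lt_of_lt_of_le (by positivity) h
  have hsym : wt j ^ 2 * ‖Complex.I * (τ : ℂ) / z‖ ≤ δ⁻¹ := by
    rw [norm_div, norm_mul, Complex.norm_I, one_mul, Complex.norm_real, Real.norm_of_nonneg hτ.le,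
      ← mul_div_assoc, div_le_iff₀ hzpos, inv_mul_eq_div, le_div_iff₀ hδ]
    linarith
  have hWs : W (s + 2) j = W s j * ENNReal.ofReal (wt j ^ 2) := by
    unfold W
    rw [← ENNReal.ofReal_mul (Real.rpow_nonneg hw.le s), Real.rpow_add hw]
    norm_num
  have h3 : ENNReal.ofReal (wt j ^ 2) * ‖Complex.I * (τ : ℂ) / z‖ₑ ≤ ENNReal.ofReal δ⁻¹ := by
    rw [← ofReal_norm, ← ENNReal.ofReal_mul (by positivity)]
    exact ENNReal.ofReal_le_ofReal hsym
  calc W (s + 2) j * ‖poissonInv d τ v j‖ₑ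
      = (ENNReal.ofReal (wt j ^ 2) * ‖Complex.I * (τ : ℂ) / z‖ₑ) * (W s j * ‖v j‖ₑ) := by
        rw [hWs, poissonInv, enorm_mul]; ring
    _ ≤ _ := by gcongr

/-! ### Multipliers -/

lemma E_mulOp {d : ℕ} {s : ℝ} (g : ℝ → ℂ) (B : ℝ) (hg : ∀ x, ‖g x‖ ≤ B) (v : Coef d) :
    E s (mulOp g v) ≤ ENNReal.ofReal B * E s v := by
  apply E_le_mul
  intro j
  rw [mulOp, enorm_mul]
  gcongr
  rw [← ofReal_norm]
  exact ENNReal.ofReal_le_ofReal (hg _)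

lemma mulOp_sub {d : ℕ} (g : ℝ → ℂ) (v w : Coef d) :
    mulOp g (v - w) = mulOp g v - mulOp g w := by
  funext j
  simp [mulOp, mul_sub]

lemma abs_sinc_le (x : ℝ) : |sinc x| ≤ 1 := by
  unfold sinc
  split_ifs with h
  · simp
  · rw [abs_div, div_le_one (abs_pos.2 h)]
    exact Real.abs_sin_le_abs

lemma E_freeOpInv {d : ℕ} {s : ℝ} (τ : ℝ) (v : Coef d) : E s (freeOpInv τ v) ≤ E s v := by
  have h := E_mulOp (s := s) (fun x => Complex.exp (Complex.I * (τ : ℂ) * ((x : ℂ)) ^ 2)) 1 (by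
    intro x
    have : Complex.I * (τ : ℂ) * ((x : ℂ)) ^ 2 = ((τ * x ^ 2 : ℝ) : ℂ) * Complex.I := by
      push_cast; ring
    rw [this, Complex.norm_exp_ofReal_mul_I]) v
  simpa [freeOpInv] using h

lemma E_sincOp {d : ℕ} {s : ℝ} (τ : ℝ) (v : Coef d) : E s (sincOp τ v) ≤ E s v := by
  have h := E_mulOp (s := s) (fun x => ((sinc (τ * x) : ℝ) : ℂ)) 1 (by
    intro x
    rw [Complex.norm_real]
    exact abs_sinc_le _) v
  simpa [sincOp] using h

lemma E_sincHalfSqOp {d : ℕ} {s : ℝ} (τ : ℝ) (v : Coef d) : E s (sincHalfSqOp τ v) ≤ E s v := by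
  have h := E_mulOp (s := s) (fun x => ((sinc (τ * x / 2) ^ 2 : ℝ) : ℂ)) 1 (by
    intro x
    rw [Complex.norm_real, norm_pow, Real.norm_eq_abs]
    exact pow_le_one₀ (abs_nonneg _) (abs_sinc_le _)) v
  simpa [sincHalfSqOp] using h

lemma E_sincm1Op {d : ℕ} {s : ℝ} (τ : ℝ) (v : Coef d) : E s (sincm1Op τ v) ≤ 2 * E s v := by
  have h := E_mulOp (s := s) (fun x => ((sinc (τ * x) - 1 : ℝ) : ℂ)) 2 (by
    intro x
    rw [Complex.norm_real, Real.norm_eq_abs]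
    have := abs_le.1 (abs_sinc_le (τ * x))
    rw [abs_le]
    constructor <;> linarith) v
  simpa [sincm1Op] using h

/-! ### Lipschitz estimates -/

lemma E_absSq_sub {d : ℕ} {s : ℝ} (hs : (d : ℝ) / 2 < s) {p p' : Coef d} {R : ℝ≥0∞}
    (hR : R ≠ ⊤) (hp : E s p ≤ R) (hp' : E s p' ≤ R) :
    E s (absSq p - absSq p') ≤ 2 * (cA d s * R) * E s (p - p') := by
  have hpt := ne_top_of_le_ne_top hR hp
  have hpt' := ne_top_of_le_ne_top hR hp'
  have hconj : conjC p - conjC p' = conjC (p - p') := by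
    funext j; simp [conjC]
  calc E s (absSq p - absSq p')
      ≤ cA d s * (E s (p - p') * E s (conjC p)) + cA d s * (E s p' * E s (conjC p - conjC p')) :=
        E_conv_sub hs hpt hpt' (by rwa [E_conj]) (by rwa [E_conj])
    _ ≤ cA d s * (E s (p - p') * R) + cA d s * (R * E s (p - p')) := by
        rw [hconj, E_conj, E_conj]; gcongr
    _ = _ := by ring

lemma E_absSq_ne_top {d : ℕ} {s : ℝ} (hs : (d : ℝ) / 2 < s) {p : Coef d} (hp : E s p ≠ ⊤) :
    E s (absSq p) ≠ ⊤ := by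
  have hs0 : 0 ≤ s := le_trans (by positivity) hs.le
  refine ne_top_of_le_ne_top ?_ (E_conv hs0 p (conjC p))
  rw [E_conj]
  exact ENNReal.mul_ne_top (cA_ne_top hs) (ENNReal.mul_ne_top hp hp)

/-- Lipschitz constant of `v` with respect to `p`. -/
def cV (d : ℕ) (s : ℝ) (R : ℝ≥0∞) : ℝ≥0∞ := 2 * (cI d s * (2 * (cA d s * R)))

lemma cV_ne_top {d : ℕ} {s : ℝ} (hs : (d : ℝ) / 2 < s) {R : ℝ≥0∞} (hR : R ≠ ⊤) :
    cV d s R ≠ ⊤ := by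
  unfold cV
  exact ENNReal.mul_ne_top (by simp) (ENNReal.mul_ne_top (cI_ne_top hs)
    (ENNReal.mul_ne_top (by simp) (ENNReal.mul_ne_top (cA_ne_top hs) hR)))

lemma E_vNew_sub {d K : ℕ} (hd : 1 ≤ d) {s : ℝ} (hs : (d : ℝ) / 2 < s) {R T' : ℝ≥0∞}
    (hR : R ≠ ⊤) {τ : ℝ} (hτ : 0 < τ) (hτT : ENNReal.ofReal τ ≤ T') (u u' ud ud' : Coef d)
    {p p' : Coef d} (hp : E s p ≤ R) (hp' : E s p' ≤ R) :
    E s (vNew d K τ u ud p - vNew d K τ u' ud' p') ≤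
      E s (u - u') + T' * E s (ud - ud') + cV d s R * E s (p - p') := by
  have hs0 : 0 ≤ s := le_trans (by positivity) hs.le
  have h1 := E_absSq_ne_top hs (ne_top_of_le_ne_top hR hp)
  have h2 := E_absSq_ne_top hs (ne_top_of_le_ne_top hR hp')
  have heq : vNew d K τ u ud p - vNew d K τ u' ud' p' =
      sincOp τ (u - u') - ((τ / 2 : ℝ) : ℂ) • sincHalfSqOp τ (ud - ud')
        + sincm1Op τ (interp d K (absSq p - absSq p')) := by
    rw [interp_sub hd hs h1 h2]
    simp only [vNew, sincOp, sincHalfSqOp, sincm1Op, mulOp_sub, smul_sub]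
    abel
  rw [heq]
  refine (E_add _ _).trans (add_le_add ((E_sub _ _).trans (add_le_add (E_sincOp _ _) ?_)) ?_)
  · refine (E_smul _ _).trans (mul_le_mul' ?_ (E_sincHalfSqOp _ _))
    rw [← ofReal_norm, Complex.norm_real, Real.norm_of_nonneg (by linarith)]
    exact (ENNReal.ofReal_le_ofReal (by linarith)).trans hτT
  · calc _ ≤ 2 * E s (interp d K (absSq p - absSq p')) := E_sincm1Op _ _
      _ ≤ 2 * (cI d s * E s (absSq p - absSq p')) := by gcongr; exact E_interp hd hs0 _
      _ ≤ 2 * (cI d s * (2 * (cA d s * R) * E s (p - p'))) := by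
          gcongr; exact E_absSq_sub hs hR hp hp'
      _ = _ := by unfold cV; ring

lemma vNew_zero {d K : ℕ} (τ : ℝ) : vNew d K τ 0 0 0 = 0 := by
  funext j
  simp [vNew, sincOp, sincHalfSqOp, sincm1Op, mulOp, interp, absSq, conv]

lemma E_zero {d : ℕ} (s : ℝ) : E s (0 : Coef d) = 0 := by simp [E, F2]

lemma E_vNew {d K : ℕ} (hd : 1 ≤ d) {s : ℝ} (hs : (d : ℝ) / 2 < s) {R T' : ℝ≥0∞}
    (hR : R ≠ ⊤) {τ : ℝ} (hτ : 0 < τ) (hτT : ENNReal.ofReal τ ≤ T') (u ud : Coef d)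
    {p : Coef d} (hp : E s p ≤ R) :
    E s (vNew d K τ u ud p) ≤ E s u + T' * E s ud + cV d s R * E s p := by
  have h := E_vNew_sub (K := K) hd hs hR hτ hτT u 0 ud 0 hp (p' := 0) (by rw [E_zero]; exact zero_le)
  simpa [vNew_zero] using h

/-- The nonlinear part of `ψ_P`. -/
def Gop {d : ℕ} (τ : ℝ) (v p : Coef d) : Coef d :=
  conv v (conv (phiC ((Complex.I * (τ : ℂ)) • v)) (freeOpInv τ p))

lemma G_lip {d : ℕ} {s : ℝ} (hs : (d : ℝ) / 2 < s) {R T' : ℝ≥0∞} (hR : R ≠ ⊤) (hT : T' ≠ ⊤) :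
    ∃ C : ℝ≥0∞, C ≠ ⊤ ∧ ∀ (τ : ℝ) (v v' p p' : Coef d), 0 < τ → ENNReal.ofReal τ ≤ T' →
      E s v ≤ R → E s v' ≤ R → E s p ≤ R → E s p' ≤ R →
      E s (Gop τ v p) ≠ ⊤ ∧
      E s (Gop τ v p - Gop τ v' p') ≤ C * (E s (v - v') + E s (p - p')) := by
  have hs0 : 0 ≤ s := le_trans (by positivity) hs.le
  have hA := cA_ne_top hs
  set A := cA d s with hAdef
  set Q := A * (T' * R) + 1 with hQ
  have hQt : Q ≠ ⊤ :=
    ENNReal.add_ne_top.2 ⟨ENNReal.mul_ne_top hA (ENNReal.mul_ne_top hT hR), by simp⟩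
  have hQ1 : 1 ≤ Q := le_add_self
  have hX := expQ_ne_top hQt
  set X := expQ Q with hXdef
  refine ⟨A * (A * (X * R)) + A * (R * (A * ((X * (A * T')) * R))) + A * (R * (A * X)), ?_, ?_⟩
  · simp only [ne_eq, ENNReal.add_eq_top, not_or]
    refine ⟨⟨?_, ?_⟩, ?_⟩ <;>
      repeat' first | exact hA | exact hR | exact hT | exact hX | apply ENNReal.mul_ne_top
  intro τ v v' p p' hτ hτT hv hv' hp hp'
  have hI : ‖Complex.I * (τ : ℂ)‖ₑ ≤ T' := by
    rw [← ofReal_norm, norm_mul, Complex.norm_I, one_mul, Complex.norm_real,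
      Real.norm_of_nonneg hτ.le]
    exact hτT
  have key : ∀ v : Coef d, E s v ≤ R → E s ((Complex.I * (τ : ℂ)) • v) ≤ T' * R := fun v hv =>
    (E_smul _ _).trans (mul_le_mul' hI hv)
  have hTR : T' * R ≠ ⊤ := ENNReal.mul_ne_top hT hR
  have keyQ : ∀ v : Coef d, E s v ≤ R → A * E s ((Complex.I * (τ : ℂ)) • v) ≤ Q := fun v hv =>
    (mul_le_mul_right (key v hv) A).trans le_self_add
  have hq : ∀ v : Coef d, E s v ≤ R → E s (phiC ((Complex.I * (τ : ℂ)) • v)) ≤ X := fun v hv =>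
    E_phiC hs0 _ (keyQ v hv)
  have hqf : ∀ v p : Coef d, E s v ≤ R → E s p ≤ R →
      E s (conv (phiC ((Complex.I * (τ : ℂ)) • v)) (freeOpInv τ p)) ≤ A * (X * R) :=
    fun v p hv hp => (E_conv hs0 _ _).trans (by
      gcongr
      · exact hq v hv
      · exact (E_freeOpInv _ _).trans hp)
  have hAXR : A * (X * R) ≠ ⊤ := ENNReal.mul_ne_top hA (ENNReal.mul_ne_top hX hR)
  constructor
  · refine ne_top_of_le_ne_top ?_ (E_conv hs0 _ _)
    exact ENNReal.mul_ne_top hA (ENNReal.mul_ne_top (ne_top_of_le_ne_top hR hv)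
      (ne_top_of_le_ne_top hAXR (hqf v p hv hp)))
  have hqd : E s (phiC ((Complex.I * (τ : ℂ)) • v) - phiC ((Complex.I * (τ : ℂ)) • v'))
      ≤ X * (A * T') * E s (v - v') := by
    refine (E_phiC_sub hs _ _ hQ1 hQt (keyQ v hv) (keyQ v' hv')
      (ne_top_of_le_ne_top hTR (key v hv)) (ne_top_of_le_ne_top hTR (key v' hv'))).trans ?_
    rw [← smul_sub, mul_assoc, mul_assoc]
    gcongr
    exact (E_smul _ _).trans (by gcongr)
  have hfd : E s (freeOpInv τ p - freeOpInv τ p') ≤ E s (p - p') := by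
    have : freeOpInv τ p - freeOpInv τ p' = freeOpInv τ (p - p') := by
      simp only [freeOpInv, mulOp_sub]
    rw [this]
    exact E_freeOpInv _ _
  have hft : ∀ p : Coef d, E s p ≤ R → E s (freeOpInv τ p) ≤ R := fun p hp =>
    (E_freeOpInv _ _).trans hp
  have hin : E s (conv (phiC ((Complex.I * (τ : ℂ)) • v)) (freeOpInv τ p)
      - conv (phiC ((Complex.I * (τ : ℂ)) • v')) (freeOpInv τ p'))
      ≤ A * ((X * (A * T') * E s (v - v')) * R) + A * (X * E s (p - p')) := by
    refine (E_conv_sub hs (ne_top_of_le_ne_top hX (hq v hv)) (ne_top_of_le_ne_top hX (hq v' hv'))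
      (ne_top_of_le_ne_top hR (hft p hp)) (ne_top_of_le_ne_top hR (hft p' hp'))).trans ?_
    gcongr
    · exact hft p hp
    · exact hq v' hv'
  calc E s (Gop τ v p - Gop τ v' p')
      ≤ A * (E s (v - v') * E s (conv (phiC ((Complex.I * (τ : ℂ)) • v)) (freeOpInv τ p)))
        + A * (E s v' * E s (conv (phiC ((Complex.I * (τ : ℂ)) • v)) (freeOpInv τ p)
          - conv (phiC ((Complex.I * (τ : ℂ)) • v')) (freeOpInv τ p'))) :=
        E_conv_sub hs (ne_top_of_le_ne_top hR hv) (ne_top_of_le_ne_top hR hv')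
          (ne_top_of_le_ne_top hAXR (hqf v p hv hp)) (ne_top_of_le_ne_top hAXR (hqf v' p' hv' hp'))
    _ ≤ A * (E s (v - v') * (A * (X * R)))
        + A * (R * (A * ((X * (A * T') * E s (v - v')) * R) + A * (X * E s (p - p')))) := by
        gcongr
        exact hqf v p hv hp
    _ = (A * (A * (X * R)) + A * (R * (A * ((X * (A * T')) * R)))) * E s (v - v')
        + A * (R * (A * X)) * E s (p - p') := by ring
    _ ≤ _ := by
        rw [mul_add]
        exact add_le_add (mul_le_mul' le_self_add le_rfl) (mul_le_mul' le_add_self le_rfl)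

lemma psiPNew_lip {d : ℕ} (hd : 1 ≤ d) {s : ℝ} (hs : (d : ℝ) / 2 < s) {c : ℝ}
    (hc : c < 2 * Real.pi) {R T' : ℝ≥0∞} (hR : R ≠ ⊤) (hT : T' ≠ ⊤) :
    ∃ C : ℝ≥0∞, C ≠ ⊤ ∧ ∀ (K : ℕ) (τ : ℝ) (φ φ' v v' p p' : Coef d), 0 < τ →
      ENNReal.ofReal τ ≤ T' → CFL d K τ c →
      E s v ≤ R → E s v' ≤ R → E s p ≤ R → E s p' ≤ R → E s φ ≤ R → E s φ' ≤ R →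
      E (s + 2) (psiPNew d K τ φ p v - psiPNew d K τ φ' p' v') ≤
        C * (E s (φ - φ') + E s (p - p') + E s (v - v')) := by
  have hs0 : 0 ≤ s := le_trans (by positivity) hs.le
  obtain ⟨P, hP, hPb⟩ := poisson_bound (d := d) s c hc
  obtain ⟨C, hC, hCb⟩ := G_lip hs hR hT
  refine ⟨P * (cI d s * (1 + C)), ENNReal.mul_ne_top hP (ENNReal.mul_ne_top (cI_ne_top hs)
    (by simp [hC])), ?_⟩
  intro K τ φ φ' v v' p p' hτ hτT hcfl hv hv' hp hp' hφ hφ'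
  obtain ⟨hG, hGd⟩ := hCb τ v v' p p' hτ hτT hv hv' hp hp'
  obtain ⟨hG', -⟩ := hCb τ v' v p' p hτ hτT hv' hv hp' hp
  have htop : ∀ φ v p : Coef d, E s φ ≤ R → E s p ≤ R → E s (Gop τ v p) ≠ ⊤ →
      E s (Complex.I • φ + p - Gop τ v p) ≠ ⊤ := by
    intro φ v p h1 h2 h3
    refine ne_top_of_le_ne_top ?_ ((E_sub _ _).trans (add_le_add_left
      ((E_add _ _).trans (add_le_add_left (E_smul _ _) _)) _))
    have h1' := ne_top_of_le_ne_top hR h1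
    have h2' := ne_top_of_le_ne_top hR h2
    simp only [ne_eq, ENNReal.add_eq_top, not_or]
    exact ⟨⟨ENNReal.mul_ne_top enorm_ne_top h1', h2'⟩, h3⟩
  have heq : psiPNew d K τ φ p v - psiPNew d K τ φ' p' v' = poissonInv d τ (interp d K
      ((Complex.I • φ + p - Gop τ v p) - (Complex.I • φ' + p' - Gop τ v' p'))) := by
    rw [interp_sub hd hs (htop φ v p hφ hp hG) (htop φ' v' p' hφ' hp' hG')]
    funext j
    simp only [psiPNew, poissonInv, Gop, Pi.sub_apply, mul_sub]
  have hdiff : (Complex.I • φ + p - Gop τ v p) - (Complex.I • φ' + p' - Gop τ v' p')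
      = Complex.I • (φ - φ') + (p - p') - (Gop τ v p - Gop τ v' p') := by
    rw [smul_sub]; abel
  rw [heq, hdiff]
  calc _ ≤ P * E s (interp d K
        (Complex.I • (φ - φ') + (p - p') - (Gop τ v p - Gop τ v' p'))) :=
        hPb K τ hτ hcfl _ (isTrig_interp _)
    _ ≤ P * (cI d s * E s (Complex.I • (φ - φ') + (p - p') - (Gop τ v p - Gop τ v' p'))) := by
        gcongr; exact E_interp hd hs0 _
    _ ≤ P * (cI d s * (E s (φ - φ') + E s (p - p') + C * (E s (v - v') + E s (p - p')))) := by
        gcongr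
        refine (E_sub _ _).trans (add_le_add ((E_add _ _).trans (add_le_add_left ?_ _)) hGd)
        refine (E_smul _ _).trans ?_
        rw [← ofReal_norm]
        simp
    _ ≤ P * (cI d s * ((1 + C) * (E s (φ - φ') + E s (p - p') + E s (v - v')))) := by
        gcongr
        rw [add_mul, one_mul]
        refine add_le_add le_self_add (mul_le_mul' le_rfl ?_)
        rw [add_comm (E s (v - v')), add_assoc]
        exact le_add_self
    _ = _ := by ring

/-! ### Trigonometric polynomials and assembly -/

lemma isTrig_sub {d K : ℕ} {v w : Coef d} (hv : isTrig d K v) (hw : isTrig d K w) :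
    isTrig d K (v - w) := fun j hj => by simp [hv j hj, hw j hj]

lemma isTrig_smul {d K : ℕ} (a : ℂ) {v : Coef d} (hv : isTrig d K v) :
    isTrig d K (a • v) := fun j hj => by simp [hv j hj]

lemma isTrig_phiK {d K : ℕ} {ψ u : ℝ → Coef d} (h : ∀ t, isTrig d K (ψ t)) (t : ℝ) :
    isTrig d K (phiK d K ψ u t) := fun j hj => by
  simp [phiK, h t j hj, isTrig_interp _ j hj]

lemma isTrig_lie {d K : ℕ} {τ : ℝ} {ψn un udn : ℕ → Coef d} (h : LieTrotter d K τ ψn un udn)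
    (h0 : isTrig d K (ψn 0) ∧ isTrig d K (un 0) ∧ isTrig d K (udn 0)) (n : ℕ) :
    isTrig d K (ψn n) ∧ isTrig d K (un n) ∧ isTrig d K (udn n) := by
  induction n with
  | zero => exact h0
  | succ n ih =>
    obtain ⟨h1, h2, h3⟩ := h n
    obtain ⟨-, i2, i3⟩ := ih
    rw [h1, h2, h3]
    refine ⟨fun j hj => ?_, fun j hj => ?_, fun j hj => ?_⟩
    · simp [psiStep, freeOp, mulOp, isTrig_interp _ j hj]
    · simp [uStep, Rop, i2 j hj, i3 j hj, isTrig_interp _ j hj]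
    · simp [uStep, Rop, i2 j hj, i3 j hj, isTrig_interp _ j hj]

lemma sobNorm_nonneg {d : ℕ} (s : ℝ) (v : Coef d) : 0 ≤ sobNorm s v := Real.sqrt_nonneg _

lemma pairNorm_nonneg {d : ℕ} (s : ℝ) (v w : Coef d) : 0 ≤ pairNorm s v w := Real.sqrt_nonneg _

lemma fst_le_pairNorm {d : ℕ} (s : ℝ) (v w : Coef d) : sobNorm (s + 1) v ≤ pairNorm s v w := by
  apply Real.le_sqrt_of_sq_le
  nlinarith [sq_nonneg (sobNorm s w)]

lemma snd_le_pairNorm {d : ℕ} (s : ℝ) (v w : Coef d) : sobNorm s w ≤ pairNorm s v w := by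
  apply Real.le_sqrt_of_sq_le
  nlinarith [sq_nonneg (sobNorm (s + 1) v)]

lemma E_le_of_sobNorm {d K : ℕ} {s r B : ℝ} (hsr : s ≤ r) {v : Coef d} (hv : isTrig d K v)
    (h : sobNorm r v ≤ B) : E s v ≤ ENNReal.ofReal B := by
  refine (E_mono_s hsr v).trans ?_
  rw [sobNorm_eq] at h
  exact (ENNReal.le_ofReal_iff_toReal_le (E_ne_top_of_isTrig r hv)
    (le_trans ENNReal.toReal_nonneg h)).2 h

lemma E_tau_sum {d : ℕ} {s τ T : ℝ} (hτ : 0 < τ) (f : ℕ → Coef d) (k : ℕ)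
    (hk : (k : ℝ) * τ ≤ T) (B : ℝ≥0∞) (hB : ∀ m < k, E s (f m) ≤ B) :
    E s ((τ : ℂ) • ∑ m ∈ Finset.range k, f m) ≤ ENNReal.ofReal T * B := by
  calc E s ((τ : ℂ) • ∑ m ∈ Finset.range k, f m)
      ≤ ‖(τ : ℂ)‖ₑ * E s (∑ m ∈ Finset.range k, f m) := E_smul _ _
    _ ≤ ENNReal.ofReal τ * ∑ m ∈ Finset.range k, E s (f m) := by
        gcongr
        · rw [← ofReal_norm, Complex.norm_real, Real.norm_of_nonneg hτ.le]
        · exact E_sum f k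
    _ ≤ ENNReal.ofReal τ * ∑ _m ∈ Finset.range k, B := by
        gcongr with m hm
        exact hB m (Finset.mem_range.1 hm)
    _ = ENNReal.ofReal (k * τ) * B := by
        rw [Finset.sum_const, Finset.card_range, nsmul_eq_mul, ENNReal.ofReal_mul (by positivity),
          ENNReal.ofReal_natCast]
        ring
    _ ≤ _ := by gcongr

lemma psin_eq {d : ℕ} {τ : ℝ} (hτ : 0 < τ) (ψn : ℕ → Coef d) (k : ℕ) :
    ψn k = ψn 0 + (τ : ℂ) • ∑ m ∈ Finset.range k, phin τ ψn (m + 1) := by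
  have hτ' : (τ : ℂ) ≠ 0 := by exact_mod_cast hτ.ne'
  induction k with
  | zero => simp
  | succ k ih =>
    rw [Finset.sum_range_succ, smul_add, ← add_assoc, ← ih, phin, smul_smul, mul_inv_cancel₀ hτ',
      one_smul]
    simp

/-- **Lemma (stability in `ψ_P`).** Under the regularity and a priori bounds and the
CFL condition, `‖ψ̂_{P,n}^K - ψ_{P,n}^K‖_{s+2} ≤ C e_n^K` for `0 ≤ t_n - t₀ ≤ T`. -/
theorem stability_psiP (d : ℕ) (hd : 1 ≤ d) (s σ M T c C₀ : ℝ)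
    (hs : (d : ℝ) / 2 < s) (hσ : 2 ≤ σ) (hM : 1 ≤ M) (hT : 0 < T)
    (hc : c < 2 * Real.pi) :
    ∃ C : ℝ, ∀ (K : ℕ) (τ : ℝ), 0 < τ → CFL d K τ c →
      ∀ (ψ u ud ψK uK udK : ℝ → Coef d) (ψn un udn : ℕ → Coef d) (t₀ : ℝ),
        ZakSol d ψ u ud →
        regBound d s σ M T t₀ ψ u ud →
        ZakSolK d K ψK uK udK →
        initK d K t₀ ψ u ud ψK uK udK →
        regHighK d K s C₀ T t₀ ψK uK udK →
        LieTrotter d K τ ψn un udn →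
        initFull d K t₀ ψ u ud ψn un udn →
        aprioriFull s (2 * C₀ * M) T τ ψn un udn →
        ∀ n : ℕ, (n : ℝ) * τ ≤ T →
          sobNorm (s + 2) (psiPhat d K τ t₀ ψK uK udK n - psiPn d K τ ψn un udn n)
            ≤ C * errFull d K s τ t₀ ψK uK udK ψn un udn n := by
  have hT' : ENNReal.ofReal T ≠ ⊤ := ENNReal.ofReal_ne_top
  set T' := ENNReal.ofReal T with hT'def
  set R0 := ENNReal.ofReal (2 * C₀ * M) with hR0def
  have hR0 : R0 ≠ ⊤ := ENNReal.ofReal_ne_top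
  set R1 := R0 + T' * R0 with hR1def
  have hR1 : R1 ≠ ⊤ := ENNReal.add_ne_top.2 ⟨hR0, ENNReal.mul_ne_top hT' hR0⟩
  have hV := cV_ne_top hs hR1
  set V := cV d s R1 with hVdef
  set R := R1 + V * R1 with hRdef
  have hR : R ≠ ⊤ := ENNReal.add_ne_top.2 ⟨hR1, ENNReal.mul_ne_top hV hR1⟩
  have hR01 : R0 ≤ R1 := le_self_add
  have hR1R : R1 ≤ R := le_self_add
  obtain ⟨C, hC, hCb⟩ := psiPNew_lip hd hs hc hR hT'
  refine ⟨(C * (1 + T' + (1 + T' + V * T'))).toReal, ?_⟩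
  intro K τ hτ hcfl ψ u ud ψK uK udK ψn un udn t₀ _ _ hsol hinit hreg hlie hfull hap n hn
  set e := errFull d K s τ t₀ ψK uK udK ψn un udn n with hedef
  have he0 : 0 ≤ e := by
    apply Real.sSup_nonneg
    rintro x ⟨m, -, rfl⟩
    exact add_nonneg (sobNorm_nonneg _ _) (pairNorm_nonneg _ _ _)
  have hψ00 : ψK t₀ = ψn 0 := by rw [hinit.1, hfull.1]
  rcases Nat.eq_zero_or_pos n with hn0 | hn1
  · subst hn0
    have : psiPhat d K τ t₀ ψK uK udK 0 - psiPn d K τ ψn un udn 0 = 0 := by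
      simp [psiPhat, psiPn, hψ00]
    rw [this, sobNorm_eq, E_zero]
    simp only [ENNReal.toReal_zero]
    exact mul_nonneg ENNReal.toReal_nonneg he0
  have htrigK := hsol.1
  have htφ : ∀ t, isTrig d K (phiK d K ψK uK t) := isTrig_phiK fun t => (htrigK t).1
  have htn := isTrig_lie hlie (by
    rw [hfull.1, hfull.2.1, hfull.2.2]
    exact ⟨isTrig_interp _, isTrig_interp _, isTrig_interp _⟩)
  have htφn : ∀ m, isTrig d K (phin τ ψn m) := fun m =>
    isTrig_smul _ (isTrig_sub (htn m).1 (htn (m - 1)).1)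
  -- times
  have htime : ∀ m : ℕ, m ≤ n → (m : ℝ) * τ ≤ T := fun m hm =>
    le_trans (by gcongr) hn
  have hτT : ENNReal.ofReal τ ≤ T' := by
    apply ENNReal.ofReal_le_ofReal
    have := htime 1 hn1
    simpa using this
  -- bounds on the semi-discrete solution
  have hC0 : 0 ≤ C₀ := le_trans (add_nonneg (add_nonneg (sobNorm_nonneg _ _)
    (pairNorm_nonneg _ _ _)) (sobNorm_nonneg _ _)) (hreg t₀ le_rfl (by linarith))
  have hC0R : ENNReal.ofReal C₀ ≤ R0 := ENNReal.ofReal_le_ofReal (by nlinarith)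
  have hK : ∀ m : ℕ, m ≤ n → E s (ψK (t₀ + m * τ)) ≤ R0 ∧ E s (uK (t₀ + m * τ)) ≤ R0 ∧
      E s (udK (t₀ + m * τ)) ≤ R0 ∧ E s (phiK d K ψK uK (t₀ + m * τ)) ≤ R0 := by
    intro m hm
    have h := hreg (t₀ + m * τ) (by nlinarith [mul_nonneg (Nat.cast_nonneg (α := ℝ) m) hτ.le])
      (by linarith [htime m hm])
    have h1 := sobNorm_nonneg (s + 4) (ψK (t₀ + m * τ))
    have h2 := pairNorm_nonneg (s + 2) (uK (t₀ + m * τ)) (udK (t₀ + m * τ))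
    have h3 := sobNorm_nonneg (s + 2) (phiK d K ψK uK (t₀ + m * τ))
    have h4 := fst_le_pairNorm (s + 2) (uK (t₀ + m * τ)) (udK (t₀ + m * τ))
    have h5 := snd_le_pairNorm (s + 2) (uK (t₀ + m * τ)) (udK (t₀ + m * τ))
    have ht := htrigK (t₀ + m * τ)
    exact ⟨(E_le_of_sobNorm (r := s + 4) (by linarith) ht.1 (by linarith)).trans hC0R,
      (E_le_of_sobNorm (r := s + 2 + 1) (by linarith) ht.2.1 (by linarith)).trans hC0R,
      (E_le_of_sobNorm (r := s + 2) (by linarith) ht.2.2 (by linarith)).trans hC0R,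
      (E_le_of_sobNorm (r := s + 2) (by linarith) (htφ _) (by linarith)).trans hC0R⟩
  -- bounds on the discrete solution
  have hN : ∀ m : ℕ, 1 ≤ m → m ≤ n → E s (un m) ≤ R0 ∧ E s (udn m) ≤ R0 ∧
      E s (phin τ ψn m) ≤ R0 := by
    intro m hm1 hm
    have h := hap m hm1 (htime m hm)
    have h1 := sobNorm_nonneg s (phin τ ψn m)
    have h2 := pairNorm_nonneg s (un m) (udn m)
    have h4 := fst_le_pairNorm s (un m) (udn m)
    have h5 := snd_le_pairNorm s (un m) (udn m)
    exact ⟨E_le_of_sobNorm (r := s + 1) (by linarith) (htn m).2.1 (by linarith),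
      E_le_of_sobNorm le_rfl (htn m).2.2 (by linarith),
      E_le_of_sobNorm le_rfl (htφn m) (by linarith)⟩
  -- error bounds
  set e' := ENNReal.ofReal e with he'
  have hE : ∀ m : ℕ, 1 ≤ m → m ≤ n →
      E s (phiK d K ψK uK (t₀ + m * τ) - phin τ ψn m) ≤ e' ∧
      E s (uK (t₀ + m * τ) - un m) ≤ e' ∧ E s (udK (t₀ + m * τ) - udn m) ≤ e' := by
    intro m hm1 hm
    have h : sobNorm s (phiK d K ψK uK (t₀ + (m : ℝ) * τ) - phin τ ψn m)
        + pairNorm s (uK (t₀ + (m : ℝ) * τ) - un m) (udK (t₀ + (m : ℝ) * τ) - udn m) ≤ e :=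
      le_csSup ((Set.finite_Icc 1 n).image _).bddAbove ⟨m, ⟨hm1, hm⟩, rfl⟩
    have h1 := sobNorm_nonneg s (phiK d K ψK uK (t₀ + (m : ℝ) * τ) - phin τ ψn m)
    have h2 := pairNorm_nonneg s (uK (t₀ + (m : ℝ) * τ) - un m) (udK (t₀ + (m : ℝ) * τ) - udn m)
    have h4 := fst_le_pairNorm s (uK (t₀ + (m : ℝ) * τ) - un m) (udK (t₀ + (m : ℝ) * τ) - udn m)
    have h5 := snd_le_pairNorm s (uK (t₀ + (m : ℝ) * τ) - un m) (udK (t₀ + (m : ℝ) * τ) - udn m)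
    have ht := htrigK (t₀ + m * τ)
    exact ⟨E_le_of_sobNorm le_rfl (isTrig_sub (htφ _) (htφn m)) (by linarith),
      E_le_of_sobNorm (r := s + 1) (by linarith) (isTrig_sub ht.2.1 (htn m).2.1) (by linarith),
      E_le_of_sobNorm le_rfl (isTrig_sub ht.2.2 (htn m).2.2) (by linarith)⟩
  have hcast : ∀ m : ℕ, t₀ + ((m : ℝ) + 1) * τ = t₀ + ((m + 1 : ℕ) : ℝ) * τ := by
    intro m; push_cast; ring
  have hψ0 : E s (ψK t₀) ≤ R0 := by
    have := (hK 0 (Nat.zero_le n)).1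
    simpa using this
  have hI1 : ∀ k ≤ n, E s (psiIhat d K τ t₀ ψK uK k) ≤ R1 := by
    intro k hk
    refine (E_add _ _).trans (add_le_add hψ0 (E_tau_sum hτ _ k (htime k hk) R0 fun m hm => ?_))
    rw [hcast]
    exact (hK (m + 1) (by omega)).2.2.2
  have hI2 : ∀ k ≤ n, E s (ψn k) ≤ R1 := by
    intro k hk
    rw [psin_eq hτ ψn k]
    refine (E_add _ _).trans (add_le_add (by rw [← hψ00]; exact hψ0)
      (E_tau_sum hτ _ k (htime k hk) R0 fun m hm => ?_))
    exact (hN (m + 1) (by omega) (by omega)).2.2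
  have hI3 : ∀ k ≤ n, E s (psiIhat d K τ t₀ ψK uK k - ψn k) ≤ T' * e' := by
    intro k hk
    have heq : psiIhat d K τ t₀ ψK uK k - ψn k = (τ : ℂ) • ∑ m ∈ Finset.range k,
        (phiK d K ψK uK (t₀ + ((m : ℝ) + 1) * τ) - phin τ ψn (m + 1)) := by
      rw [psin_eq hτ ψn k, psiIhat, hψ00, Finset.sum_sub_distrib, smul_sub]
      abel
    rw [heq]
    refine E_tau_sum hτ _ k (htime k hk) e' fun m hm => ?_
    rw [hcast]
    exact (hE (m + 1) (by omega) (by omega)).1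
  have hv1 : E s (vhat d K τ t₀ ψK uK udK n) ≤ R := by
    refine (E_vNew hd hs hR1 hτ hτT _ _ (hI1 (n - 1) (by omega))).trans ?_
    rw [hRdef, hR1def]
    have h := hK n le_rfl
    gcongr
    · exact h.2.1
    · exact h.2.2.1
    · exact hI1 (n - 1) (by omega)
  have hv2 : E s (vn d K τ ψn un udn n) ≤ R := by
    refine (E_vNew hd hs hR1 hτ hτT _ _ (hI2 (n - 1) (by omega))).trans ?_
    rw [hRdef, hR1def]
    have h := hN n hn1 le_rfl
    gcongr
    · exact h.1
    · exact h.2.1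
    · exact hI2 (n - 1) (by omega)
  have hv3 : E s (vhat d K τ t₀ ψK uK udK n - vn d K τ ψn un udn n)
      ≤ e' + T' * e' + V * (T' * e') := by
    refine (E_vNew_sub hd hs hR1 hτ hτT _ _ _ _ (hI1 (n - 1) (by omega))
      (hI2 (n - 1) (by omega))).trans ?_
    have h := hE n hn1 le_rfl
    gcongr
    · exact h.2.1
    · exact h.2.2
    · exact hI3 (n - 1) (by omega)
  have hfin : E (s + 2) (psiPhat d K τ t₀ ψK uK udK n - psiPn d K τ ψn un udn n)
      ≤ C * (1 + T' + (1 + T' + V * T')) * e' := by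
    rw [psiPhat, psiPn, if_neg (by omega), if_neg (by omega)]
    refine (hCb K τ _ _ _ _ _ _ hτ hτT hcfl hv1 hv2 ((hI1 n le_rfl).trans hR1R)
      ((hI2 n le_rfl).trans hR1R) (((hK n le_rfl).2.2.2.trans hR01).trans hR1R)
      (((hN n hn1 le_rfl).2.2.trans hR01).trans hR1R)).trans ?_
    calc _ ≤ C * (e' + T' * e' + (e' + T' * e' + V * (T' * e'))) := by
          refine mul_le_mul' le_rfl (add_le_add (add_le_add ?_ ?_) hv3)
          · exact (hE n hn1 le_rfl).1
          · exact hI3 n le_rfl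
      _ = _ := by ring
  have hCt : C * (1 + T' + (1 + T' + V * T')) ≠ ⊤ := by
    refine ENNReal.mul_ne_top hC ?_
    have h1 : V * T' ≠ ⊤ := ENNReal.mul_ne_top hV hT'
    simp only [ne_eq, ENNReal.add_eq_top, not_or]
    exact ⟨⟨by simp, hT'⟩, ⟨⟨by simp, hT'⟩, h1⟩⟩
  rw [sobNorm_eq]
  refine (ENNReal.toReal_mono (ENNReal.mul_ne_top hCt ENNReal.ofReal_ne_top) hfin).trans ?_
  rw [ENNReal.toReal_mul, ENNReal.toReal_ofReal he0]

end Zak
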